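/- Consider a discrete memoryless two-level security wiretap channel with transition probability p(y,z1,z2|x) that satisfies the Markov chains X → Z1 → Z2, X → Y → Z2, and X → Y → Z1. The secrecy capacity region of the channel equals the set of all nonnegative pairs (R1,R2) satisfying R1 ≤ I(X;Y) − I(X;Z1) and R1 + R2 ≤ I(X;Y) − I(X;Z2) for some input distribution p(x). -/

import Mathlib

open scoped BigOperators
noncomputable section

/-- A probability mass function on a finite type. -/
def IsPMF {α : Type*} [Fintype α] (p : α → ℝ) : Prop :=
  (∀ a, 0 ≤ p a) ∧ ∑ a, p a = 1

/-- A discrete channel from `α` to `β`: every input determines a pmf on outputs. -/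
def IsChannel {α β : Type*} [Fintype β] (W : α → β → ℝ) : Prop :=
  ∀ a, IsPMF (W a)

/-- Mutual information (in bits) of a joint pmf on `α × β`. -/
def mutInfo {α β : Type*} [Fintype α] [Fintype β] (p : α × β → ℝ) : ℝ :=
  ∑ ab : α × β,
    p ab * Real.logb 2 (p ab / ((∑ b, p (ab.1, b)) * (∑ a, p (a, ab.2))))

variable {𝒳 𝒴 𝒵₁ 𝒵₂ : Type} [Fintype 𝒳] [Fintype 𝒴] [Fintype 𝒵₁] [Fintype 𝒵₂]

/-- The Markov chain `X → Z₁ → Z₂` for the channel `W : 𝒳 → 𝒴 × 𝒵₁ × 𝒵₂`: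
the eavesdropper output `Z₂` is degraded with respect to `Z₁`. -/
def DegradedZ1Z2 (W : 𝒳 → 𝒴 × 𝒵₁ × 𝒵₂ → ℝ) : Prop :=
  ∃ q : 𝒵₁ → 𝒵₂ → ℝ, IsChannel q ∧
    ∀ x z₁ z₂, (∑ y, W x (y, z₁, z₂)) = (∑ y, ∑ z₂', W x (y, z₁, z₂')) * q z₁ z₂

/-- Joint pmf of messages, inputs and outputs induced by a (possibly stochastic) encoder
`enc` used on the memoryless channel `W` with uniform independent messages. -/
def codeJoint {n K₁ K₂ : ℕ} (W : 𝒳 → 𝒴 × 𝒵₁ × 𝒵₂ → ℝ)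
    (enc : Fin K₁ × Fin K₂ → (Fin n → 𝒳) → ℝ)
    (m : Fin K₁ × Fin K₂) (xs : Fin n → 𝒳) (ys : Fin n → 𝒴)
    (z1s : Fin n → 𝒵₁) (z2s : Fin n → 𝒵₂) : ℝ :=
  ((K₁ : ℝ) * (K₂ : ℝ))⁻¹ * enc m xs * ∏ i, W (xs i) (ys i, z1s i, z2s i)

/-- Average probability of a decoding error at the legitimate receiver. -/
def errProb {n K₁ K₂ : ℕ} (W : 𝒳 → 𝒴 × 𝒵₁ × 𝒵₂ → ℝ)
    (enc : Fin K₁ × Fin K₂ → (Fin n → 𝒳) → ℝ)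
    (dec : (Fin n → 𝒴) → Fin K₁ × Fin K₂) : ℝ :=
  ∑ m, ∑ xs, ∑ ys, ∑ z1s, ∑ z2s,
    if dec ys ≠ m then codeJoint W enc m xs ys z1s z2s else 0

/-- The information leakage `I(M₁,M₂; Z₂ⁿ)` to the weak eavesdropper realization. -/
def leakMZ2 {n K₁ K₂ : ℕ} (W : 𝒳 → 𝒴 × 𝒵₁ × 𝒵₂ → ℝ)
    (enc : Fin K₁ × Fin K₂ → (Fin n → 𝒳) → ℝ) : ℝ :=
  mutInfo (fun q : (Fin K₁ × Fin K₂) × (Fin n → 𝒵₂) =>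
    ∑ xs, ∑ ys, ∑ z1s, codeJoint W enc q.1 xs ys z1s q.2)

/-- The information leakage `I(M₁; Z₁ⁿ)` to the strong eavesdropper realization. -/
def leakM1Z1 {n K₁ K₂ : ℕ} (W : 𝒳 → 𝒴 × 𝒵₁ × 𝒵₂ → ℝ)
    (enc : Fin K₁ × Fin K₂ → (Fin n → 𝒳) → ℝ) : ℝ :=
  mutInfo (fun q : Fin K₁ × (Fin n → 𝒵₁) =>
    ∑ m₂, ∑ xs, ∑ ys, ∑ z2s, codeJoint W enc (q.1, m₂) xs ys q.2 z2s)

/-- A rate pair `(R₁,R₂)` is achievable for the two-level security wiretap channel `W`: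
there are codes of blocklength `n` whose rates are arbitrarily close to `(R₁,R₂)`, with
vanishing error probability at the legitimate receiver, vanishing normalized leakage
`(1/n) I(M₁,M₂;Z₂ⁿ)` of both messages to the weak eavesdropper realization, and vanishing
normalized leakage `(1/n) I(M₁;Z₁ⁿ)` of the high-security message to the strong one. -/
def Achievable (W : 𝒳 → 𝒴 × 𝒵₁ × 𝒵₂ → ℝ) (R₁ R₂ : ℝ) : Prop :=
  ∀ ε > 0, ∃ n : ℕ, 0 < n ∧ ∃ K₁ K₂ : ℕ, 0 < K₁ ∧ 0 < K₂ ∧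
    (n : ℝ) * (R₁ - ε) ≤ Real.logb 2 K₁ ∧ (n : ℝ) * (R₂ - ε) ≤ Real.logb 2 K₂ ∧
    ∃ enc : Fin K₁ × Fin K₂ → (Fin n → 𝒳) → ℝ, IsChannel enc ∧
      ∃ dec : (Fin n → 𝒴) → Fin K₁ × Fin K₂,
        errProb W enc dec ≤ ε ∧
        leakMZ2 W enc ≤ (n : ℝ) * ε ∧
        leakM1Z1 W enc ≤ (n : ℝ) * ε

/-- Joint pmf of the input and the legitimate receiver output. -/
def jointXY (pX : 𝒳 → ℝ) (W : 𝒳 → 𝒴 × 𝒵₁ × 𝒵₂ → ℝ) : 𝒳 × 𝒴 → ℝ :=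
  fun q => pX q.1 * ∑ z₁, ∑ z₂, W q.1 (q.2, z₁, z₂)

/-- Joint pmf of the input and the strong eavesdropper output. -/
def jointXZ1 (pX : 𝒳 → ℝ) (W : 𝒳 → 𝒴 × 𝒵₁ × 𝒵₂ → ℝ) : 𝒳 × 𝒵₁ → ℝ :=
  fun q => pX q.1 * ∑ y, ∑ z₂, W q.1 (y, q.2, z₂)

/-- Joint pmf of the input and the weak eavesdropper output. -/
def jointXZ2 (pX : 𝒳 → ℝ) (W : 𝒳 → 𝒴 × 𝒵₁ × 𝒵₂ → ℝ) : 𝒳 × 𝒵₂ → ℝ :=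
  fun q => pX q.1 * ∑ y, ∑ z₁, W q.1 (y, z₁, q.2)

/-- The Markov chain `X → Y → Z₂` for the channel `W`: the weak eavesdropper output `Z₂`
is degraded with respect to the legitimate receiver output `Y`. -/
def DegradedYZ2 (W : 𝒳 → 𝒴 × 𝒵₁ × 𝒵₂ → ℝ) : Prop :=
  ∃ q : 𝒴 → 𝒵₂ → ℝ, IsChannel q ∧
    ∀ x y z₂, (∑ z₁, W x (y, z₁, z₂)) = (∑ z₁, ∑ z₂', W x (y, z₁, z₂')) * q y z₂

/-- The Markov chain `X → Y → Z₁` for the channel `W`: the strong eavesdropper output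
`Z₁` is degraded with respect to the legitimate receiver output `Y`. -/
def DegradedYZ1 (W : 𝒳 → 𝒴 × 𝒵₁ × 𝒵₂ → ℝ) : Prop :=
  ∃ q : 𝒴 → 𝒵₁ → ℝ, IsChannel q ∧
    ∀ x y z₁, (∑ z₂, W x (y, z₁, z₂)) = (∑ z₁', ∑ z₂, W x (y, z₁', z₂)) * q y z₁

set_option linter.unusedSectionVars false

/-! ### Information-theoretic preliminaries (natural logarithms) -/

/-- Shannon entropy in nats. -/
def ent {α : Type*} [Fintype α] (p : α → ℝ) : ℝ := ∑ a, Real.negMulLog (p a)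

/-- Output measure of a channel. -/
def outp {α β : Type*} [Fintype α] (P : α → ℝ) (V : α → β → ℝ) : β → ℝ :=
  fun b => ∑ a, P a * V a b

/-- Mutual information in nats between input and output. -/
def minf {α β : Type*} [Fintype α] [Fintype β] (P : α → ℝ) (V : α → β → ℝ) : ℝ :=
  ent (outp P V) - ∑ a, P a * ent (V a)

/-- Relative entropy in nats. -/
def kl {α : Type*} [Fintype α] (P R : α → ℝ) : ℝ := ∑ a, P a * Real.log (P a / R a)

/-- Memoryless extension of a channel. -/
def prodch {α β : Type*} (n : ℕ) (V : α → β → ℝ) : (Fin n → α) → (Fin n → β) → ℝ :=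
  fun xs ys => ∏ i, V (xs i) (ys i)

/-- one-term lower bound used in the log-sum inequality -/
lemma logsum_term {a b A B : ℝ} (ha : 0 ≤ a) (hb : 0 ≤ b) (h : b = 0 → a = 0)
    (hA : 0 < A) (hB : 0 < B) :
    a * Real.log (A / B) + (a - b * (A / B)) ≤ a * Real.log (a / b) := by
  rcases ha.eq_or_lt with rfl | ha'
  · have : 0 ≤ b * (A / B) := by positivity
    simp; linarith
  · have hb' : 0 < b := lt_of_le_of_ne hb (fun hh => by have := h hh.symm; linarith)
    have h1 := Real.log_le_sub_one_of_pos (x := (A / B) / (a / b)) (by positivity)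
    rw [Real.log_div (by positivity) (by positivity)] at h1
    have h2 : a * ((A / B) / (a / b) - 1) = b * (A / B) - a := by field_simp
    have h3 := mul_le_mul_of_nonneg_left h1 ha
    nlinarith

lemma logsum {ι : Type*} (s : Finset ι) (a b : ι → ℝ) (ha : ∀ i ∈ s, 0 ≤ a i)
    (hb : ∀ i ∈ s, 0 ≤ b i) (h : ∀ i ∈ s, b i = 0 → a i = 0) :
    (∑ i ∈ s, a i) * Real.log ((∑ i ∈ s, a i) / ∑ i ∈ s, b i) ≤
      ∑ i ∈ s, a i * Real.log (a i / b i) := by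
  have hA := Finset.sum_nonneg ha
  have hB := Finset.sum_nonneg hb
  rcases hA.eq_or_lt with hA0 | hA'
  · have : ∀ i ∈ s, a i = 0 := (Finset.sum_eq_zero_iff_of_nonneg ha).1 hA0.symm
    rw [← hA0, zero_mul]
    exact (Finset.sum_eq_zero (fun i hi => by rw [this i hi]; simp)).symm.le
  rcases hB.eq_or_lt with hB0 | hB'
  · have : ∀ i ∈ s, b i = 0 := (Finset.sum_eq_zero_iff_of_nonneg hb).1 hB0.symm
    have : ∑ i ∈ s, a i = 0 := Finset.sum_eq_zero (fun i hi => h i hi (this i hi))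
    linarith
  have := Finset.sum_le_sum (fun i hi => logsum_term (ha i hi) (hb i hi) (h i hi) hA' hB')
  rw [Finset.sum_add_distrib, Finset.sum_sub_distrib, ← Finset.sum_mul, ← Finset.sum_mul] at this
  have h2 : (∑ i ∈ s, b i) * ((∑ i ∈ s, a i) / ∑ i ∈ s, b i) = ∑ i ∈ s, a i := by field_simp
  linarith

section basics
variable {α β γ : Type*} [Fintype α] [Fintype β] [Fintype γ]

lemma outp_nonneg {P : α → ℝ} {V : α → β → ℝ} (hP : ∀ a, 0 ≤ P a) (hV : ∀ a b, 0 ≤ V a b) (b : β) :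
    0 ≤ outp P V b := Finset.sum_nonneg fun a _ => mul_nonneg (hP a) (hV a b)

lemma outp_sum {P : α → ℝ} {V : α → β → ℝ} (hV : IsChannel V) : ∑ b, outp P V b = ∑ a, P a := by
  unfold outp
  rw [Finset.sum_comm]
  refine Finset.sum_congr rfl fun a _ => ?_
  rw [← Finset.mul_sum, (hV a).2, mul_one]

lemma outp_pmf {P : α → ℝ} {V : α → β → ℝ} (hP : IsPMF P) (hV : IsChannel V) : IsPMF (outp P V) :=
  ⟨outp_nonneg hP.1 fun a => (hV a).1, by rw [outp_sum hV, hP.2]⟩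

lemma outp_channel {E : α → β → ℝ} {V : β → γ → ℝ} (hE : IsChannel E) (hV : IsChannel V) :
    IsChannel (fun a => outp (E a) V) := fun a => outp_pmf (hE a) hV

lemma outp_assoc (P : α → ℝ) (V : α → β → ℝ) (q : β → γ → ℝ) :
    outp (outp P V) q = outp P (fun a => outp (V a) q) := by
  funext c
  simp only [outp, Finset.sum_mul, Finset.mul_sum]
  rw [Finset.sum_comm]
  simp only [mul_assoc]

lemma outp_zero {P : α → ℝ} {V : α → β → ℝ} (hP : ∀ a, 0 ≤ P a) (hV : ∀ a b, 0 ≤ V a b) {b : β}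
    (h : outp P V b = 0) (a : α) : P a * V a b = 0 :=
  (Finset.sum_eq_zero_iff_of_nonneg (fun a _ => mul_nonneg (hP a) (hV a b))).1 h a (Finset.mem_univ _)

lemma kl_dpi {P R : α → ℝ} {q : α → β → ℝ} (hP : ∀ a, 0 ≤ P a) (hR : ∀ a, 0 ≤ R a)
    (h : ∀ a, R a = 0 → P a = 0) (hq : IsChannel q) :
    kl (outp P q) (outp R q) ≤ kl P R := by
  have h1 : ∀ b, outp P q b * Real.log (outp P q b / outp R q b) ≤
      ∑ a, (P a * Real.log (P a / R a)) * q a b := by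
    intro b
    refine (logsum Finset.univ (fun a => P a * q a b) (fun a => R a * q a b)
      (fun a _ => mul_nonneg (hP a) ((hq a).1 b)) (fun a _ => mul_nonneg (hR a) ((hq a).1 b))
      (fun a _ h0 => ?_)).trans (le_of_eq (Finset.sum_congr rfl fun a _ => ?_))
    · rcases mul_eq_zero.1 h0 with h0 | h0 <;> simp [h0, h a]
    · by_cases h0 : q a b = 0
      · simp [h0]
      · rw [mul_div_mul_right _ _ h0]; ring
  unfold kl
  refine (Finset.sum_le_sum fun b _ => h1 b).trans (le_of_eq ?_)
  exact outp_sum (P := fun a => P a * Real.log (P a / R a)) hq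

lemma kl_nonneg {P R : α → ℝ} (hP : IsPMF P) (hR : IsPMF R)
    (h : ∀ a, R a = 0 → P a = 0) : 0 ≤ kl P R := by
  have := logsum Finset.univ P R (fun a _ => hP.1 a) (fun a _ => hR.1 a) (fun a _ => h a)
  rw [hP.2, hR.2] at this
  simpa [kl] using this

lemma mul_log_div {p v o : ℝ} (h : o = 0 → p * v = 0) :
    p * (v * Real.log (v / o)) = p * (-Real.negMulLog v) - p * v * Real.log o := by
  by_cases hv : v = 0
  · simp [hv]
  by_cases ho : o = 0
  · have := h ho
    have hp : p = 0 := by simpa [hv] using this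
    simp [hp]
  · rw [Real.log_div hv ho, Real.negMulLog]; ring

/-- compensation identity -/
lemma sum_kl {P : α → ℝ} {V : α → β → ℝ} (Q : β → ℝ)
    (hQ : ∀ a b, Q b = 0 → P a * V a b = 0) :
    ∑ a, P a * kl (V a) Q = - (∑ a, P a * ent (V a)) - ∑ b, outp P V b * Real.log (Q b) := by
  have h1 : ∀ a, P a * kl (V a) Q = - (P a * ent (V a)) - ∑ b, P a * V a b * Real.log (Q b) := by
    intro a
    unfold kl ent
    rw [Finset.mul_sum, Finset.sum_congr rfl (fun b _ => mul_log_div (hQ a b)),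
      Finset.sum_sub_distrib, ← Finset.mul_sum, Finset.sum_neg_distrib, mul_neg]
  rw [Finset.sum_congr rfl (fun a _ => h1 a), Finset.sum_sub_distrib, Finset.sum_neg_distrib]
  congr 1
  rw [Finset.sum_comm]
  simp [outp, Finset.sum_mul]

lemma minf_eq_kl {P : α → ℝ} {V : α → β → ℝ} (hP : ∀ a, 0 ≤ P a) (hV : ∀ a b, 0 ≤ V a b) :
    minf P V = ∑ a, P a * kl (V a) (outp P V) := by
  rw [sum_kl _ (fun a b h => outp_zero hP hV h a)]
  unfold minf
  have : ent (outp P V) = - ∑ b, outp P V b * Real.log (outp P V b) := by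
    simp [ent, Real.negMulLog]
  rw [this]; ring

lemma minf_le_kl {P : α → ℝ} {V : α → β → ℝ} {Q : β → ℝ} (hP : IsPMF P) (hV : IsChannel V)
    (hQp : IsPMF Q) (hQ : ∀ a b, Q b = 0 → P a * V a b = 0) :
    minf P V ≤ ∑ a, P a * kl (V a) Q := by
  rw [sum_kl Q hQ]
  have h0 : ∀ b, Q b = 0 → outp P V b = 0 := fun b hb => Finset.sum_eq_zero fun a _ => hQ a b hb
  have := kl_nonneg (outp_pmf hP hV) hQp h0
  have h2 := sum_kl (P := fun _ : Unit => (1:ℝ)) (V := fun _ => outp P V) Q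
    (fun a b hb => by simp [h0 b hb])
  simp [outp] at h2
  unfold minf
  have h3 : kl (outp P V) Q = kl (fun b ↦ ∑ a, P a * V a b) Q := rfl
  have h4 : ent (outp P V) = ent (fun b ↦ ∑ a, P a * V a b) := rfl
  simp only [outp] at *
  linarith

lemma minf_dpi {P : α → ℝ} {V : α → β → ℝ} {q : β → γ → ℝ} (hP : ∀ a, 0 ≤ P a)
    (hV : ∀ a b, 0 ≤ V a b) (hq : IsChannel q) :
    minf P (fun a => outp (V a) q) ≤ minf P V := by
  rw [minf_eq_kl hP hV, minf_eq_kl hP (fun a => outp_nonneg (hV a) fun a => (hq a).1),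
    ← outp_assoc]
  refine Finset.sum_le_sum fun a _ => ?_
  rcases (hP a).eq_or_lt with h | h
  · simp [← h]
  · refine mul_le_mul_of_nonneg_left (kl_dpi (hV a) (outp_nonneg hP hV) (fun b hb => ?_) hq) (hP a)
    have := outp_zero hP hV hb a
    simpa [h.ne'] using this

lemma minf_chain (π : α → ℝ) (E : α → β → ℝ) (V : β → γ → ℝ) :
    minf π (fun a => outp (E a) V) = minf (outp π E) V - ∑ a, π a * minf (E a) V := by
  unfold minf
  rw [outp_assoc]
  simp only [mul_sub, Finset.sum_sub_distrib]
  have : ∑ a, outp π E a * ent (V a) = ∑ a, π a * ∑ b, E a b * ent (V b) := by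
    simp only [outp, Finset.sum_mul, Finset.mul_sum]
    rw [Finset.sum_comm]; simp only [mul_assoc]
  rw [this]; ring

lemma gap_le {π : α → ℝ} {E : α → β → ℝ} {V : β → γ → ℝ} {δ : Type*} [Fintype δ] {q : γ → δ → ℝ}
    (hπ : ∀ a, 0 ≤ π a) (hE : ∀ a b, 0 ≤ E a b) (hV : ∀ a b, 0 ≤ V a b) (hq : IsChannel q) :
    minf π (fun a => outp (E a) V) - minf π (fun a => outp (E a) (fun b => outp (V b) q)) ≤
      minf (outp π E) V - minf (outp π E) (fun b => outp (V b) q) := by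
  rw [minf_chain, minf_chain]
  have : ∑ a, π a * minf (E a) (fun b => outp (V b) q) ≤ ∑ a, π a * minf (E a) V :=
    Finset.sum_le_sum fun a _ => mul_le_mul_of_nonneg_left (minf_dpi (hE a) hV hq) (hπ a)
  linarith

lemma gap_concave {π : α → ℝ} {E : α → β → ℝ} {V : β → γ → ℝ} {δ : Type*} [Fintype δ] {q : γ → δ → ℝ}
    (hπ : ∀ a, 0 ≤ π a) (hE : ∀ a b, 0 ≤ E a b) (hV : ∀ a b, 0 ≤ V a b) (hq : IsChannel q) :
    ∑ a, π a * (minf (E a) V - minf (E a) (fun b => outp (V b) q)) ≤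
      minf (outp π E) V - minf (outp π E) (fun b => outp (V b) q) := by
  have h1 := minf_chain π E V
  have h2 := minf_chain π E (fun b => outp (V b) q)
  have h3 : minf π (fun a => outp (outp (E a) V) q) ≤ minf π (fun a => outp (E a) V) :=
    minf_dpi hπ (fun a => outp_nonneg (hE a) hV) hq
  simp only [outp_assoc] at h3
  simp only [mul_sub, Finset.sum_sub_distrib]
  linarith

lemma mutInfo_eq {P : α → ℝ} {V : α → β → ℝ} (hP : ∀ a, 0 ≤ P a) (hV : IsChannel V) :
    mutInfo (fun q : α × β => P q.1 * V q.1 q.2) = minf P V / Real.log 2 := by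
  rw [minf_eq_kl hP (fun a => (hV a).1)]
  unfold mutInfo kl
  simp only [Fintype.sum_prod_type, Finset.sum_div, Finset.mul_sum]
  refine Finset.sum_congr rfl fun a _ => Finset.sum_congr rfl fun b _ => ?_
  have hs : ∑ x, P a * V a x = P a := by rw [← Finset.mul_sum, (hV a).2, mul_one]
  rw [hs, Real.logb]
  by_cases h : P a = 0
  · simp [h]
  · rw [← Finset.mul_sum, mul_div_mul_left _ _ h]; unfold outp; ring

end basics

section prods
variable {α β γ : Type*} [Fintype α] [Fintype β] [Fintype γ]

/-- marginal at coordinate `i` -/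
def marg {n : ℕ} (Q : (Fin n → α) → ℝ) (i : Fin n) (a : α) : ℝ :=
  open Classical in ∑ s, if s i = a then Q s else 0

lemma sum_marg {n : ℕ} (Q : (Fin n → α) → ℝ) (i : Fin n) (f : α → ℝ) :
    ∑ a, marg Q i a * f a = ∑ s, Q s * f (s i) := by
  classical
  simp only [marg, Finset.sum_mul]
  rw [Finset.sum_comm]
  refine Finset.sum_congr rfl fun s _ => ?_
  simp [ite_mul]

lemma marg_nonneg {n : ℕ} {Q : (Fin n → α) → ℝ} (h : ∀ s, 0 ≤ Q s) (i : Fin n) (a : α) :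
    0 ≤ marg Q i a := by
  classical
  exact Finset.sum_nonneg fun s _ => by split_ifs <;> simp [h s]

lemma marg_pmf {n : ℕ} {Q : (Fin n → α) → ℝ} (h : IsPMF Q) (i : Fin n) : IsPMF (marg Q i) :=
  ⟨marg_nonneg h.1 i, by simpa [h.2] using sum_marg Q i (fun _ => 1)⟩

lemma sum_prod_fun {ι : Type*} [Fintype ι] [DecidableEq ι] (f : ι → α → ℝ) :
    ∑ s : ι → α, ∏ i, f i (s i) = ∏ i, ∑ a, f i a := by
  rw [Finset.prod_univ_sum]; simp

lemma prodch_channel {n : ℕ} {V : α → β → ℝ} (hV : IsChannel V) : IsChannel (prodch n V) := by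
  intro xs
  refine ⟨fun ys => Finset.prod_nonneg fun i _ => (hV _).1 _, ?_⟩
  unfold prodch
  rw [sum_prod_fun (fun i => V (xs i))]
  simp [(hV _).2]

/-- product-measure expectation of a function of one coordinate -/
lemma prod_exp_one {ι : Type*} [Fintype ι] [DecidableEq ι] (p : ι → α → ℝ)
    (hp : ∀ i, ∑ a, p i a = 1) (i : ι) (f : α → ℝ) :
    ∑ s : ι → α, (∏ j, p j (s j)) * f (s i) = ∑ a, p i a * f a := by
  have : ∀ s : ι → α, (∏ j, p j (s j)) * f (s i) =
      ∏ j, (p j (s j) * if j = i then f (s j) else 1) := by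
    intro s
    rw [Finset.prod_mul_distrib]; simp
  rw [Finset.sum_congr rfl (fun s _ => this s),
    sum_prod_fun (fun j a => p j a * if j = i then f a else 1),
    Finset.prod_eq_single i]
  · simp
  · intro b _ hb; simp [hb, hp]
  · simp

lemma prod_exp_two {ι : Type*} [Fintype ι] [DecidableEq ι] (p : ι → α → ℝ)
    (hp : ∀ i, ∑ a, p i a = 1) {i k : ι} (hik : i ≠ k) (f g : α → ℝ) :
    ∑ s : ι → α, (∏ j, p j (s j)) * (f (s i) * g (s k)) =
      (∑ a, p i a * f a) * ∑ a, p k a * g a := by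
  have : ∀ s : ι → α, (∏ j, p j (s j)) * (f (s i) * g (s k)) =
      ∏ j, (p j (s j) * ((if j = i then f (s j) else 1) * (if j = k then g (s j) else 1))) := by
    intro s
    rw [Finset.prod_mul_distrib, Finset.prod_mul_distrib]; simp
  rw [Finset.sum_congr rfl (fun s _ => this s),
    sum_prod_fun (fun j a => p j a * ((if j = i then f a else 1) * (if j = k then g a else 1))),
    ← Finset.prod_subset (Finset.subset_univ {i, k}), Finset.prod_pair hik]
  · simp [hik, hik.symm]
  · intro b _ hb; simp at hb; simp [hb, hp]

lemma ent_prodch {n : ℕ} {V : α → β → ℝ} (hV : IsChannel V) (xs : Fin n → α) :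
    ent (prodch n V xs) = ∑ i, ent (V (xs i)) := by
  have h1 : ∀ ys : Fin n → β, Real.negMulLog (prodch n V xs ys) =
      ∑ i, (∏ j, V (xs j) (ys j)) * (- Real.log (V (xs i) (ys i))) := by
    intro ys
    unfold Real.negMulLog prodch
    rw [← Finset.mul_sum, Finset.sum_neg_distrib]
    by_cases h : ∏ j, V (xs j) (ys j) = 0
    · simp [h]
    · rw [Real.log_prod (fun i _ => (Finset.prod_ne_zero_iff.1 h) i (Finset.mem_univ _))]; ring
  unfold ent
  rw [Finset.sum_congr rfl (fun ys _ => h1 ys), Finset.sum_comm]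
  refine Finset.sum_congr rfl fun i _ => ?_
  rw [prod_exp_one (fun j => V (xs j)) (fun j => (hV _).2) i (fun y => - Real.log (V (xs i) y))]
  simp [Real.negMulLog]

lemma marg_outp {n : ℕ} {V : α → β → ℝ} (hV : IsChannel V) (P : (Fin n → α) → ℝ) (i : Fin n) :
    marg (outp P (prodch n V)) i = outp (marg P i) V := by
  classical
  funext b
  have h1 := sum_marg P i (fun a => V a b)
  unfold outp
  rw [h1]
  unfold marg
  have : ∀ s : Fin n → β, (if s i = b then ∑ a, P a * prodch n V a s else 0) =
      ∑ a, P a * (prodch n V a s * if s i = b then 1 else 0) := by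
    intro s; split_ifs <;> simp
  simp only [this]
  rw [Finset.sum_comm]
  refine Finset.sum_congr rfl fun xs _ => ?_
  rw [← Finset.mul_sum]
  have := prod_exp_one (fun j => V (xs j)) (fun j => (hV _).2) i (fun y => if y = b then 1 else 0)
  unfold prodch
  rw [this]; simp

lemma prodch_comp {n : ℕ} (V : α → β → ℝ) (q : β → γ → ℝ) (xs : Fin n → α) :
    outp (prodch n V xs) (prodch n q) = prodch n (fun x => outp (V x) q) xs := by
  funext zs
  unfold outp prodch
  simp only [← Finset.prod_mul_distrib]
  rw [sum_prod_fun (fun i b => V (xs i) b * q b (zs i))]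

/-- product of marginals -/
def prodmarg {n : ℕ} (Q : (Fin n → α) → ℝ) : (Fin n → α) → ℝ := fun s => ∏ i, marg Q i (s i)

lemma le_marg {n : ℕ} {Q : (Fin n → α) → ℝ} (h : ∀ s, 0 ≤ Q s) (i : Fin n) (s : Fin n → α) :
    Q s ≤ marg Q i (s i) := by
  classical
  have := Finset.single_le_sum (f := fun t : Fin n → α => if t i = s i then Q t else 0)
    (fun t _ => by split_ifs <;> simp [h t]) (Finset.mem_univ s)
  simpa [marg] using this

lemma prodmarg_zero {n : ℕ} {Q : (Fin n → α) → ℝ} (h : ∀ s, 0 ≤ Q s) (s : Fin n → α)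
    (h0 : prodmarg Q s = 0) : Q s = 0 := by
  obtain ⟨i, _, hi⟩ := Finset.prod_eq_zero_iff.1 h0
  exact le_antisymm (by simpa [hi] using le_marg h i s) (h s)

lemma tc_eq {n : ℕ} {Q : (Fin n → α) → ℝ} (h : ∀ s, 0 ≤ Q s) :
    kl Q (prodmarg Q) = ∑ i, ent (marg Q i) - ent Q := by
  have h1 : ∀ s, Q s * Real.log (Q s / prodmarg Q s) =
      - Real.negMulLog (Q s) + ∑ i, Q s * (- Real.log (marg Q i (s i))) := by
    intro s
    by_cases hs : Q s = 0
    · simp [hs]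
    have hm : prodmarg Q s ≠ 0 := fun h0 => hs (prodmarg_zero h s h0)
    rw [Real.log_div hs hm, prodmarg, Real.log_prod (fun i _ => (Finset.prod_ne_zero_iff.1 hm) i (Finset.mem_univ _)),
      Real.negMulLog, ← Finset.mul_sum, Finset.sum_neg_distrib]
    ring
  unfold kl
  rw [Finset.sum_congr rfl (fun s _ => h1 s), Finset.sum_add_distrib, Finset.sum_comm,
    Finset.sum_neg_distrib]
  have h2 : ∀ i, ∑ s, Q s * (- Real.log (marg Q i (s i))) = ent (marg Q i) := by
    intro i
    rw [← sum_marg Q i (fun a => - Real.log (marg Q i a))]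
    simp [ent, Real.negMulLog]
  simp only [h2, ent]; ring

lemma minf_prodch {n : ℕ} {V : α → β → ℝ} (hV : IsChannel V) (P : (Fin n → α) → ℝ) :
    minf P (prodch n V) = ent (outp P (prodch n V)) - ∑ i, ∑ a, marg P i a * ent (V a) := by
  unfold minf
  congr 1
  simp only [ent_prodch hV, sum_marg, Finset.mul_sum]
  rw [Finset.sum_comm]

lemma gap_single {n : ℕ} {V : α → β → ℝ} {q : β → γ → ℝ} (hV : IsChannel V) (hq : IsChannel q)
    {P : (Fin n → α) → ℝ} (hP : IsPMF P) :
    minf P (prodch n V) - minf P (prodch n (fun x => outp (V x) q)) ≤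
      ∑ i, (minf (marg P i) V - minf (marg P i) (fun x => outp (V x) q)) := by
  have hV' : IsChannel (fun x => outp (V x) q) := outp_channel hV hq
  have hQ : ∀ s, 0 ≤ outp P (prodch n V) s := (outp_pmf hP (prodch_channel hV)).1
  have key := kl_dpi (P := outp P (prodch n V)) (R := prodmarg (outp P (prodch n V)))
    (q := prodch n q) hQ (fun s => Finset.prod_nonneg fun i _ => marg_nonneg hQ i _)
    (fun s => prodmarg_zero hQ s) (prodch_channel hq)
  have e1 : outp (outp P (prodch n V)) (prodch n q) = outp P (prodch n (fun x => outp (V x) q)) := by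
    rw [outp_assoc]; simp only [prodch_comp]
  have e2 : outp (prodmarg (outp P (prodch n V))) (prodch n q) =
      prodmarg (outp P (prodch n (fun x => outp (V x) q))) := by
    funext zs
    simp only [outp, prodmarg, prodch, ← Finset.prod_mul_distrib]
    rw [sum_prod_fun (fun i b => marg (outp P (prodch n V)) i b * q b (zs i))]
    refine Finset.prod_congr rfl fun i _ => ?_
    rw [marg_outp hV, marg_outp hV', ← outp_assoc]; rfl
  rw [e1, e2, tc_eq hQ, tc_eq (outp_pmf hP (prodch_channel hV')).1] at key
  simp only [marg_outp hV, marg_outp hV'] at key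
  rw [minf_prodch hV, minf_prodch hV']
  simp only [minf, Finset.sum_sub_distrib]
  linarith

end prods
/-! ### Converse -/

section marginals

/-- marginal channel to the legitimate receiver -/
def chY (W : 𝒳 → 𝒴 × 𝒵₁ × 𝒵₂ → ℝ) : 𝒳 → 𝒴 → ℝ := fun x y => ∑ z₁, ∑ z₂, W x (y, z₁, z₂)
/-- marginal channel to the strong eavesdropper -/
def ch1 (W : 𝒳 → 𝒴 × 𝒵₁ × 𝒵₂ → ℝ) : 𝒳 → 𝒵₁ → ℝ := fun x z₁ => ∑ y, ∑ z₂, W x (y, z₁, z₂)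
/-- marginal channel to the weak eavesdropper -/
def ch2 (W : 𝒳 → 𝒴 × 𝒵₁ × 𝒵₂ → ℝ) : 𝒳 → 𝒵₂ → ℝ := fun x z₂ => ∑ y, ∑ z₁, W x (y, z₁, z₂)

variable {W : 𝒳 → 𝒴 × 𝒵₁ × 𝒵₂ → ℝ}

lemma chY_channel (hW : IsChannel W) : IsChannel (chY W) := by
  intro x
  refine ⟨fun y => Finset.sum_nonneg fun _ _ => Finset.sum_nonneg fun _ _ => (hW x).1 _, ?_⟩
  have := (hW x).2
  simp only [Fintype.sum_prod_type] at this
  exact this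

lemma ch1_channel (hW : IsChannel W) : IsChannel (ch1 W) := by
  intro x
  refine ⟨fun y => Finset.sum_nonneg fun _ _ => Finset.sum_nonneg fun _ _ => (hW x).1 _, ?_⟩
  have := (hW x).2
  simp only [Fintype.sum_prod_type] at this
  unfold ch1
  rw [Finset.sum_comm]; exact this

lemma ch2_channel (hW : IsChannel W) : IsChannel (ch2 W) := by
  intro x
  refine ⟨fun y => Finset.sum_nonneg fun _ _ => Finset.sum_nonneg fun _ _ => (hW x).1 _, ?_⟩
  have := (hW x).2
  simp only [Fintype.sum_prod_type] at this
  unfold ch2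
  rw [Finset.sum_comm, ← this]
  refine Finset.sum_congr rfl fun y _ => ?_
  rw [Finset.sum_comm]

lemma ch2_deg (h : DegradedYZ2 W) : ∃ q : 𝒴 → 𝒵₂ → ℝ, IsChannel q ∧
    ch2 W = fun x => outp (chY W x) q := by
  obtain ⟨q, hq, h⟩ := h
  refine ⟨q, hq, ?_⟩
  funext x z
  exact Finset.sum_congr rfl fun y _ => h x y z

lemma ch1_deg (h : DegradedYZ1 W) : ∃ q : 𝒴 → 𝒵₁ → ℝ, IsChannel q ∧
    ch1 W = fun x => outp (chY W x) q := by
  obtain ⟨q, hq, h⟩ := h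
  refine ⟨q, hq, ?_⟩
  funext x z
  exact Finset.sum_congr rfl fun y _ => h x y z

lemma mutInfo_XY (hW : IsChannel W) {pX : 𝒳 → ℝ} (hp : IsPMF pX) :
    mutInfo (jointXY pX W) = minf pX (chY W) / Real.log 2 := mutInfo_eq hp.1 (chY_channel hW)
lemma mutInfo_XZ1 (hW : IsChannel W) {pX : 𝒳 → ℝ} (hp : IsPMF pX) :
    mutInfo (jointXZ1 pX W) = minf pX (ch1 W) / Real.log 2 := mutInfo_eq hp.1 (ch1_channel hW)
lemma mutInfo_XZ2 (hW : IsChannel W) {pX : 𝒳 → ℝ} (hp : IsPMF pX) :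
    mutInfo (jointXZ2 pX W) = minf pX (ch2 W) / Real.log 2 := mutInfo_eq hp.1 (ch2_channel hW)

lemma sum_W_Y {n : ℕ} (xs : Fin n → 𝒳) (ys : Fin n → 𝒴) :
    ∑ z1s : Fin n → 𝒵₁, ∑ z2s : Fin n → 𝒵₂, ∏ i, W (xs i) (ys i, z1s i, z2s i) =
      prodch n (chY W) xs ys := by
  have : ∀ z1s : Fin n → 𝒵₁, ∑ z2s : Fin n → 𝒵₂, ∏ i, W (xs i) (ys i, z1s i, z2s i) =
      ∏ i, ∑ z2, W (xs i) (ys i, z1s i, z2) := fun z1s =>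
    sum_prod_fun (fun i z2 => W (xs i) (ys i, z1s i, z2))
  simp only [this]
  exact sum_prod_fun (fun i z1 => ∑ z2, W (xs i) (ys i, z1, z2))

lemma sum_W_1 {n : ℕ} (xs : Fin n → 𝒳) (z1s : Fin n → 𝒵₁) :
    ∑ ys : Fin n → 𝒴, ∑ z2s : Fin n → 𝒵₂, ∏ i, W (xs i) (ys i, z1s i, z2s i) =
      prodch n (ch1 W) xs z1s := by
  have : ∀ ys : Fin n → 𝒴, ∑ z2s : Fin n → 𝒵₂, ∏ i, W (xs i) (ys i, z1s i, z2s i) =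
      ∏ i, ∑ z2, W (xs i) (ys i, z1s i, z2) := fun ys =>
    sum_prod_fun (fun i z2 => W (xs i) (ys i, z1s i, z2))
  simp only [this]
  exact sum_prod_fun (fun i y => ∑ z2, W (xs i) (y, z1s i, z2))

lemma sum_W_2 {n : ℕ} (xs : Fin n → 𝒳) (z2s : Fin n → 𝒵₂) :
    ∑ ys : Fin n → 𝒴, ∑ z1s : Fin n → 𝒵₁, ∏ i, W (xs i) (ys i, z1s i, z2s i) =
      prodch n (ch2 W) xs z2s := by
  have : ∀ ys : Fin n → 𝒴, ∑ z1s : Fin n → 𝒵₁, ∏ i, W (xs i) (ys i, z1s i, z2s i) =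
      ∏ i, ∑ z1, W (xs i) (ys i, z1, z2s i) := fun ys =>
    sum_prod_fun (fun i z1 => W (xs i) (ys i, z1, z2s i))
  simp only [this]
  exact sum_prod_fun (fun i y => ∑ z1, W (xs i) (y, z1, z2s i))

/-- the encoder averaged over the low-security message -/
def enc1 {n K₁ K₂ : ℕ} (enc : Fin K₁ × Fin K₂ → (Fin n → 𝒳) → ℝ) : Fin K₁ → (Fin n → 𝒳) → ℝ :=
  fun m₁ xs => ∑ m₂, (K₂ : ℝ)⁻¹ * enc (m₁, m₂) xs

/-- uniform distribution -/
def unif (α : Type*) [Fintype α] : α → ℝ := fun _ => (Fintype.card α : ℝ)⁻¹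

lemma unif_pmf (α : Type*) [Fintype α] [Nonempty α] : IsPMF (unif α) := by
  refine ⟨fun a => by unfold unif; positivity, ?_⟩
  have : (Fintype.card α : ℝ) ≠ 0 := by exact_mod_cast Fintype.card_ne_zero
  simp [unif, this]

lemma enc1_channel {n K₁ K₂ : ℕ} (hK : 0 < K₂) {enc : Fin K₁ × Fin K₂ → (Fin n → 𝒳) → ℝ}
    (h : IsChannel enc) : IsChannel (enc1 enc) := by
  intro m
  refine ⟨fun xs => Finset.sum_nonneg fun m₂ _ => mul_nonneg (by positivity) ((h _).1 _), ?_⟩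
  unfold enc1
  rw [Finset.sum_comm]
  simp only [← Finset.mul_sum, (h _).2]
  have : (K₂ : ℝ) ≠ 0 := by positivity
  simp [this]

lemma outp_enc1 {n K₁ K₂ : ℕ} (enc : Fin K₁ × Fin K₂ → (Fin n → 𝒳) → ℝ) :
    outp (unif (Fin K₁)) (enc1 enc) = outp (unif (Fin K₁ × Fin K₂)) enc := by
  funext xs
  simp only [outp, enc1, unif, Fintype.sum_prod_type, Finset.mul_sum]
  refine Finset.sum_congr rfl fun _ _ => Finset.sum_congr rfl fun _ _ => ?_
  simp only [Fintype.card_fin, Fintype.card_prod, Nat.cast_mul, mul_inv]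
  ring

lemma leakMZ2_eq {n K₁ K₂ : ℕ} (hW : IsChannel W)
    {enc : Fin K₁ × Fin K₂ → (Fin n → 𝒳) → ℝ} (h : IsChannel enc) :
    leakMZ2 W enc = minf (unif (Fin K₁ × Fin K₂)) (fun m => outp (enc m) (prodch n (ch2 W))) /
      Real.log 2 := by
  rw [← mutInfo_eq (fun a => by unfold unif; positivity)
    (outp_channel h (prodch_channel (ch2_channel hW)))]
  unfold leakMZ2 codeJoint
  congr 1
  funext q
  simp only [← Finset.mul_sum, sum_W_2, outp, unif]
  simp only [mul_assoc, ← Finset.mul_sum]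
  simp

lemma leakM1Z1_eq {n K₁ K₂ : ℕ} (hK : 0 < K₂) (hW : IsChannel W)
    {enc : Fin K₁ × Fin K₂ → (Fin n → 𝒳) → ℝ} (h : IsChannel enc) :
    leakM1Z1 W enc = minf (unif (Fin K₁)) (fun m => outp (enc1 enc m) (prodch n (ch1 W))) /
      Real.log 2 := by
  rw [← mutInfo_eq (fun a => by unfold unif; positivity)
    (outp_channel (enc1_channel hK h) (prodch_channel (ch1_channel hW)))]
  unfold leakM1Z1 codeJoint
  congr 1
  funext q
  simp only [← Finset.mul_sum, sum_W_1, outp, unif, enc1]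
  simp only [Finset.sum_mul, Finset.mul_sum]
  rw [Finset.sum_comm]
  refine Finset.sum_congr rfl fun _ _ => Finset.sum_congr rfl fun _ _ => ?_
  simp only [Fintype.card_fin, mul_inv]
  ring

/-- generic average error probability -/
def errG {M β : Type*} [Fintype M] [Fintype β] (V : M → β → ℝ) (dec : β → M) : ℝ :=
  open Classical in ∑ m, ∑ b, if dec b ≠ m then unif M m * V m b else 0

lemma errProb_eq {n K₁ K₂ : ℕ} (enc : Fin K₁ × Fin K₂ → (Fin n → 𝒳) → ℝ)
    (dec : (Fin n → 𝒴) → Fin K₁ × Fin K₂) :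
    errProb W enc dec = errG (fun m => outp (enc m) (prodch n (chY W))) dec := by
  classical
  unfold errProb errG codeJoint
  refine Finset.sum_congr rfl fun m _ => ?_
  rw [Finset.sum_comm]
  refine Finset.sum_congr rfl fun ys _ => ?_
  by_cases h : dec ys = m
  · simp [h]
  · simp only [ne_eq, h, not_false_eq_true, if_true, ← Finset.mul_sum, sum_W_Y, outp, unif]
    simp only [mul_assoc, ← Finset.mul_sum]
    simp

lemma fano {M β : Type*} [Fintype M] [Nonempty M] [Fintype β] {V : M → β → ℝ} (hV : IsChannel V)
    (dec : β → M) :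
    (1 - errG V dec) * Real.log (Fintype.card M) - Real.binEntropy (errG V dec) ≤
      minf (unif M) V := by
  classical
  have hU := unif_pmf M
  have hK : (0:ℝ) < Fintype.card M := by exact_mod_cast Fintype.card_pos
  have hO := outp_pmf hU hV
  set K : ℝ := (Fintype.card M : ℝ)
  set O := outp (unif M) V
  let a : M × β → ℝ := fun q => unif M q.1 * V q.1 q.2
  let b : M × β → ℝ := fun q => unif M q.1 * O q.2
  have ha : ∀ q, 0 ≤ a q := fun q => mul_nonneg (hU.1 _) ((hV _).1 _)
  have hb : ∀ q, 0 ≤ b q := fun q => mul_nonneg (hU.1 _) (hO.1 _)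
  have hab : ∀ q, b q = 0 → a q = 0 := by
    intro q h
    have hu : unif M q.1 ≠ 0 := by simp [unif]
    have : O q.2 = 0 := by simpa [b, hu] using h
    exact outp_zero hU.1 (fun m => (hV m).1) this q.1
  have hmi : minf (unif M) V = ∑ q, a q * Real.log (a q / b q) := by
    rw [minf_eq_kl hU.1 (fun m => (hV m).1), Fintype.sum_prod_type]
    refine Finset.sum_congr rfl fun m _ => ?_
    unfold kl
    rw [Finset.mul_sum]
    refine Finset.sum_congr rfl fun y _ => ?_
    have hu : unif M m ≠ 0 := by simp [unif]
    simp only [a, b]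
    rw [mul_div_mul_left _ _ hu]; ring
  have hasum : ∑ q, a q = 1 := by
    rw [Fintype.sum_prod_type]
    simp only [a, ← Finset.mul_sum, (hV _).2, mul_one]; exact hU.2
  have hbsum : ∑ q, b q = 1 := by
    rw [Fintype.sum_prod_type]
    simp only [b, ← Finset.mul_sum, hO.2, mul_one]; exact hU.2
  let S : Finset (M × β) := Finset.univ.filter (fun q => dec q.2 = q.1)
  have he : ∑ q ∈ Sᶜ, a q = errG V dec := by
    simp only [S, errG]
    rw [Finset.compl_filter, Finset.sum_filter, Fintype.sum_prod_type]
  have heS : ∑ q ∈ S, a q = 1 - errG V dec := by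
    rw [← he, ← hasum, ← Finset.sum_add_sum_compl S]; ring
  have hbS : ∑ q ∈ S, b q = K⁻¹ := by
    simp only [S]
    rw [Finset.sum_filter, Fintype.sum_prod_type, Finset.sum_comm]
    simp only [b, Finset.sum_ite_eq, Finset.mem_univ, if_true, unif]
    rw [← Finset.mul_sum, hO.2, mul_one]
  have hbS' : ∑ q ∈ Sᶜ, b q ≤ 1 := by
    rw [← hbsum]; exact Finset.sum_le_sum_of_subset_of_nonneg (Finset.subset_univ _) (fun q _ _ => hb q)
  set e := errG V dec
  have he0 : 0 ≤ e := he ▸ Finset.sum_nonneg fun q _ => ha q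
  have he1 : 0 ≤ 1 - e := heS ▸ Finset.sum_nonneg fun q _ => ha q
  have l1 := logsum S a b (fun q _ => ha q) (fun q _ => hb q) (fun q _ => hab q)
  have l2 := logsum Sᶜ a b (fun q _ => ha q) (fun q _ => hb q) (fun q _ => hab q)
  rw [heS, hbS] at l1
  rw [he] at l2
  rw [hmi, ← Finset.sum_add_sum_compl S]
  have m1 : (1 - e) * Real.log K + (1 - e) * Real.log (1 - e) ≤ (1 - e) * Real.log ((1 - e) / K⁻¹) := by
    rcases he1.eq_or_lt with h | h
    · simp [← h]
    · rw [Real.log_div h.ne' (by positivity), Real.log_inv]; apply le_of_eq; ring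
  have m2 : e * Real.log e ≤ e * Real.log (e / ∑ q ∈ Sᶜ, b q) := by
    rcases he0.eq_or_lt with h | h
    · simp [← h]
    · refine mul_le_mul_of_nonneg_left (Real.log_le_log h ?_) he0
      have hB0 : 0 ≤ ∑ q ∈ Sᶜ, b q := Finset.sum_nonneg fun q _ => hb q
      have hB : 0 < ∑ q ∈ Sᶜ, b q := by
        rcases hB0.eq_or_lt with hh | hh
        · have h0 := (Finset.sum_eq_zero_iff_of_nonneg (fun q _ => hb q)).1 hh.symm
          have : ∑ q ∈ Sᶜ, a q = 0 := Finset.sum_eq_zero fun q hq => hab q (h0 q hq)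
          linarith
        · exact hh
      rw [le_div_iff₀ hB]
      nlinarith
  rw [Real.binEntropy_eq_negMulLog_add_negMulLog_one_sub, Real.negMulLog, Real.negMulLog]
  linarith

lemma errG_fst {n K₁ K₂ : ℕ} (hW : IsChannel W) {enc : Fin K₁ × Fin K₂ → (Fin n → 𝒳) → ℝ}
    (h : IsChannel enc) (dec : (Fin n → 𝒴) → Fin K₁ × Fin K₂) :
    errG (fun m => outp (enc1 enc m) (prodch n (chY W))) (fun y => (dec y).1) ≤
      errG (fun m => outp (enc m) (prodch n (chY W))) dec := by
  classical
  unfold errG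
  rw [Fintype.sum_prod_type]
  refine Finset.sum_le_sum fun m₁ _ => ?_
  rw [Finset.sum_comm]
  refine Finset.sum_le_sum fun ys _ => ?_
  have hn : ∀ m, 0 ≤ outp (enc m) (prodch n (chY W)) ys :=
    fun m => (outp_channel h (prodch_channel (chY_channel hW)) m).1 ys
  have hu : 0 ≤ (Fintype.card (Fin K₁ × Fin K₂) : ℝ)⁻¹ := by positivity
  split_ifs with hd
  · have : ∀ m₂, dec ys ≠ (m₁, m₂) := fun m₂ hh => hd (by simp [hh])
    simp only [this, ne_eq, not_false_eq_true, if_true]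
    apply le_of_eq
    simp only [outp, enc1, unif, Finset.sum_mul, Finset.mul_sum]
    rw [Finset.sum_comm]
    refine Finset.sum_congr rfl fun _ _ => Finset.sum_congr rfl fun _ _ => ?_
    simp only [Fintype.card_fin, Fintype.card_prod, Nat.cast_mul, mul_inv]
    ring
  · exact Finset.sum_nonneg fun m₂ _ => by
      split_ifs
      · exact mul_nonneg hu (hn _)
      · exact le_rfl

lemma code_gap {n : ℕ} (hn : 0 < n) {α β γ M : Type*} [Fintype α] [Fintype β] [Fintype γ] [Fintype M]
    [Nonempty M] {V : α → β → ℝ} {q : β → γ → ℝ} (hV : IsChannel V) (hq : IsChannel q)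
    {E : M → (Fin n → α) → ℝ} (hE : IsChannel E) :
    minf (unif M) (fun m => outp (E m) (prodch n V)) -
      minf (unif M) (fun m => outp (E m) (prodch n (fun x => outp (V x) q))) ≤
    n * (minf (outp (unif (Fin n)) (marg (outp (unif M) E))) V -
      minf (outp (unif (Fin n)) (marg (outp (unif M) E))) (fun x => outp (V x) q)) := by
  have hU := unif_pmf M
  have : Nonempty (Fin n) := ⟨⟨0, hn⟩⟩
  have hP := outp_pmf hU hE
  have h1 := gap_le (π := unif M) (E := E) (V := prodch n V) (q := prodch n q) hU.1
    (fun m => (hE m).1) (fun x => (prodch_channel hV x).1) (prodch_channel hq)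
  simp only [prodch_comp] at h1
  have h2 := gap_single hV hq hP
  have h3 := gap_concave (π := unif (Fin n)) (E := marg (outp (unif M) E)) (V := V) (q := q)
    (unif_pmf _).1 (fun i => (marg_pmf hP i).1) (fun x => (hV x).1) hq
  have hn' : (0:ℝ) < n := by exact_mod_cast hn
  simp only [unif, ← Finset.mul_sum, Fintype.card_fin] at h3
  rw [inv_mul_le_iff₀ hn'] at h3
  exact h1.trans (h2.trans h3)

lemma converse_step (hW : IsChannel W) (hdeg₂ : DegradedYZ2 W) (hdeg₃ : DegradedYZ1 W) {R₁ R₂ : ℝ}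
    (h : Achievable W R₁ R₂) {ε : ℝ} (h0 : 0 < ε) (h1 : ε ≤ 1 / 2) :
    ∃ pX : 𝒳 → ℝ, IsPMF pX ∧
      (1 - ε) * (R₁ - ε) * Real.log 2 - ε * Real.log 2 - Real.binEntropy ε ≤
        minf pX (chY W) - minf pX (ch1 W) ∧
      (1 - ε) * (R₁ + R₂ - 2 * ε) * Real.log 2 - ε * Real.log 2 - Real.binEntropy ε ≤
        minf pX (chY W) - minf pX (ch2 W) := by
  obtain ⟨n, hn, K₁, K₂, hK₁, hK₂, hr1, hr2, enc, henc, dec, herr, hl2, hl1⟩ := h ε h0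
  obtain ⟨q1, hq1, hc1⟩ := ch1_deg hdeg₃
  obtain ⟨q2, hq2, hc2⟩ := ch2_deg hdeg₂
  have hVY := chY_channel hW
  have : Nonempty (Fin K₁) := ⟨⟨0, hK₁⟩⟩
  have : Nonempty (Fin K₂) := ⟨⟨0, hK₂⟩⟩
  have : Nonempty (Fin n) := ⟨⟨0, hn⟩⟩
  have hl : 0 < Real.log 2 := Real.log_pos (by norm_num)
  have hn1 : (1:ℝ) ≤ n := by exact_mod_cast hn
  rw [leakM1Z1_eq hK₂ hW henc, div_le_iff₀ hl, hc1] at hl1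
  rw [leakMZ2_eq hW henc, div_le_iff₀ hl, hc2] at hl2
  rw [errProb_eq] at herr
  rw [Real.logb, le_div_iff₀ hl] at hr1 hr2
  have henc1 := enc1_channel hK₂ henc
  have g2 := code_gap hn hVY hq2 henc
  have g1 := code_gap hn hVY hq1 henc1
  rw [outp_enc1] at g1
  have f2 := fano (outp_channel henc (prodch_channel (n := n) hVY)) dec
  have f1 := fano (outp_channel henc1 (prodch_channel (n := n) hVY)) (fun y => (dec y).1)
  have herr1 := (errG_fst hW henc dec).trans herr
  have pX := outp_pmf (unif_pmf (Fin n)) (fun i => marg_pmf (outp_pmf (unif_pmf (Fin K₁ × Fin K₂)) henc) i)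
  refine ⟨_, pX, ?_, ?_⟩
  all_goals
    have nn : ∀ {M β : Type} [Fintype M] [Fintype β] (V : M → β → ℝ), IsChannel V → ∀ dec, 0 ≤ errG V dec := by
      intro M β _ _ V hV dec
      unfold errG
      refine Finset.sum_nonneg fun m _ => Finset.sum_nonneg fun b _ => ?_
      split_ifs
      · exact mul_nonneg (by unfold unif; positivity) ((hV m).1 b)
      · exact le_rfl
    have mono : ∀ e, 0 ≤ e → e ≤ ε → Real.binEntropy e ≤ Real.binEntropy ε := fun e he hee =>
      Real.binEntropy_strictMonoOn.monotoneOn ⟨he, by norm_num; linarith⟩ ⟨h0.le, by norm_num; linarith⟩ hee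
    have hh : 0 ≤ Real.binEntropy ε := Real.binEntropy_nonneg h0.le (by linarith)
  · rw [hc1]
    set G := minf _ (chY W) - minf _ (fun x => outp (chY W x) q1)
    have hm := mono _ (nn _ (outp_channel henc1 (prodch_channel (n := n) hVY)) _) herr1
    simp only [Fintype.card_fin] at f1
    have hlk : 0 ≤ Real.log (K₁:ℝ) := Real.log_natCast_nonneg _
    have s1 : (1 - ε) * (n * (R₁ - ε) * Real.log 2) ≤ (1 - ε) * Real.log K₁ :=
      mul_le_mul_of_nonneg_left hr1 (by linarith)
    have s2 := mul_le_mul_of_nonneg_right herr1 hlk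
    have : (n:ℝ) * ((1 - ε) * (R₁ - ε) * Real.log 2 - ε * Real.log 2 - Real.binEntropy ε) ≤ n * G := by
      nlinarith [mul_le_mul_of_nonneg_right hn1 hh]
    exact le_of_mul_le_mul_left this (by linarith)
  · rw [hc2]
    set G := minf _ (chY W) - minf _ (fun x => outp (chY W x) q2)
    have hm := mono _ (nn _ (outp_channel henc (prodch_channel (n := n) hVY)) _) herr
    simp only [Fintype.card_fin, Fintype.card_prod, Nat.cast_mul] at f2
    rw [Real.log_mul (by positivity) (by positivity)] at f2
    have hlk : 0 ≤ Real.log (K₁:ℝ) + Real.log K₂ :=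
      add_nonneg (Real.log_natCast_nonneg _) (Real.log_natCast_nonneg _)
    have s1 : (1 - ε) * (n * (R₁ + R₂ - 2 * ε) * Real.log 2) ≤ (1 - ε) * (Real.log K₁ + Real.log K₂) :=
      mul_le_mul_of_nonneg_left (by linarith) (by linarith)
    have s2 := mul_le_mul_of_nonneg_right herr hlk
    have : (n:ℝ) * ((1 - ε) * (R₁ + R₂ - 2 * ε) * Real.log 2 - ε * Real.log 2 - Real.binEntropy ε) ≤ n * G := by
      nlinarith [mul_le_mul_of_nonneg_right hn1 hh]
    exact le_of_mul_le_mul_left this (by linarith)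

lemma minf_continuous {α β : Type*} [Fintype α] [Fintype β] (V : α → β → ℝ) :
    Continuous (fun P : α → ℝ => minf P V) := by
  unfold minf ent outp
  have := Real.continuous_negMulLog
  fun_prop

lemma converse (hW : IsChannel W) (hdeg₂ : DegradedYZ2 W) (hdeg₃ : DegradedYZ1 W) {R₁ R₂ : ℝ}
    (h : Achievable W R₁ R₂) : ∃ pX : 𝒳 → ℝ, IsPMF pX ∧
      R₁ * Real.log 2 ≤ minf pX (chY W) - minf pX (ch1 W) ∧
      (R₁ + R₂) * Real.log 2 ≤ minf pX (chY W) - minf pX (ch2 W) := by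
  let e : ℕ → ℝ := fun k => 1 / ((k:ℝ) + 2)
  have he0 : ∀ k, 0 < e k := fun k => by positivity
  have he1 : ∀ k, e k ≤ 1 / 2 := fun k => by
    apply one_div_le_one_div_of_le (by norm_num); linarith [(Nat.cast_nonneg k : (0:ℝ) ≤ k)]
  have het : Filter.Tendsto e Filter.atTop (nhds 0) := by
    have := (tendsto_one_div_add_atTop_nhds_zero_nat (𝕜 := ℝ)).comp (Filter.tendsto_add_atTop_nat 1)
    refine this.congr fun k => ?_
    simp only [Function.comp, e]; push_cast; ring
  choose p hp h1 h2 using fun k => converse_step hW hdeg₂ hdeg₃ h (he0 k) (he1 k)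
  obtain ⟨P, hP, φ, hφ, hlim⟩ := (isCompact_stdSimplex ℝ 𝒳).tendsto_subseq (x := p) (fun k => hp k)
  refine ⟨P, hP, ?_, ?_⟩
  · have c : Continuous fun x : ℝ => (1 - x) * (R₁ - x) * Real.log 2 - x * Real.log 2 - Real.binEntropy x := by
      have := Real.binEntropy_continuous
      fun_prop
    have t1 := (c.tendsto 0).comp (het.comp hφ.tendsto_atTop)
    have t2 := (((minf_continuous (chY W)).sub (minf_continuous (ch1 W))).tendsto P).comp hlim
    have := le_of_tendsto_of_tendsto' t1 t2 (fun k => h1 (φ k))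
    simpa using this
  · have c : Continuous fun x : ℝ => (1 - x) * (R₁ + R₂ - 2 * x) * Real.log 2 - x * Real.log 2 - Real.binEntropy x := by
      have := Real.binEntropy_continuous
      fun_prop
    have t1 := (c.tendsto 0).comp (het.comp hφ.tendsto_atTop)
    have t2 := (((minf_continuous (chY W)).sub (minf_continuous (ch2 W))).tendsto P).comp hlim
    have := le_of_tendsto_of_tendsto' t1 t2 (fun k => h2 (φ k))
    simpa using this

end marginals
/-! ### Random coding -/

section oneshot
variable {A B J J0 : Type*} [Fintype A] [Fintype B] [Fintype J] [Fintype J0] [DecidableEq J]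

/-- probability of an i.i.d. codebook -/
def cbw {A J : Type*} [Fintype J] (P : A → ℝ) (c : J → A) : ℝ := ∏ j, P (c j)

lemma cbw_pmf {P : A → ℝ} (hP : IsPMF P) : IsPMF (cbw (J := J) P) := by
  refine ⟨fun c => Finset.prod_nonneg fun j _ => hP.1 _, ?_⟩
  unfold cbw
  rw [sum_prod_fun (fun _ => P)]; simp [hP.2]

lemma cbw_one {P : A → ℝ} (hP : IsPMF P) (i : J) (f : A → ℝ) :
    ∑ c : J → A, cbw P c * f (c i) = ∑ a, P a * f a :=
  prod_exp_one (fun _ => P) (fun _ => hP.2) i f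

lemma cbw_two {P : A → ℝ} (hP : IsPMF P) {i k : J} (h : i ≠ k) (f g : A → ℝ) :
    ∑ c : J → A, cbw P c * (f (c i) * g (c k)) = (∑ a, P a * f a) * ∑ a, P a * g a :=
  prod_exp_two (fun _ => P) (fun _ => hP.2) h f g

/-- output distribution induced by a sub-codebook -/
def mix (V : A → B → ℝ) (φ : J0 → J) (c : J → A) : B → ℝ :=
  outp (unif J0) (fun j => V (c (φ j)))

lemma soft_term {P : A → ℝ} (hP : IsPMF P) {V : A → B → ℝ} (hV : IsChannel V) [Nonempty J0]
    (φ : J0 → J) (hφ : Function.Injective φ) (z : B) (j : J0) :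
    ∑ c : J → A, cbw P c * (V (c (φ j)) z * Real.log (mix V φ c z / outp P V z)) ≤
      ∑ a, P a * (V a z * Real.log (1 + V a z / (Fintype.card J0 * outp P V z))) := by
  classical
  have hQ0 : 0 ≤ outp P V z := outp_nonneg hP.1 (fun a => (hV a).1) z
  rcases hQ0.eq_or_lt with hQ | hQ
  · simp [← hQ]
  have hK : (0:ℝ) < Fintype.card J0 := by exact_mod_cast Fintype.card_pos
  have hQdef : ∑ a, P a * V a z = outp P V z := rfl
  set Q := outp P V z
  set K : ℝ := (Fintype.card J0 : ℝ)
  let s : A → ℝ := fun a => 1 + V a z / (K * Q)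
  have hv : ∀ a, 0 ≤ V a z := fun a => (hV a).1 z
  have hs : ∀ a, 0 < s a := fun a => by have := hv a; simp only [s]; positivity
  let h : A → ℝ := fun a => V a z / s a
  have hh : ∀ a, 0 ≤ h a := fun a => div_nonneg (hv a) (hs a).le
  have hmix : ∀ c : J → A, mix V φ c z = K⁻¹ * ∑ k, V (c (φ k)) z := by
    intro c; simp only [mix, outp, unif, ← Finset.mul_sum]; rfl
  have pt : ∀ c : J → A, V (c (φ j)) z * Real.log (mix V φ c z / Q) ≤
      V (c (φ j)) z * Real.log (s (c (φ j))) +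
        ((K * Q)⁻¹ * ∑ k, h (c (φ j)) * V (c (φ k)) z - V (c (φ j)) z) := by
    intro c
    have e : (K * Q)⁻¹ * ∑ k, h (c (φ j)) * V (c (φ k)) z =
        V (c (φ j)) z * ((mix V φ c z / Q) / s (c (φ j))) := by
      rw [hmix, ← Finset.mul_sum]; simp only [h]
      have := (hs (c (φ j))).ne'
      field_simp
    rw [e]
    rcases (hv (c (φ j))).eq_or_lt with h0 | h0
    · simp [← h0]
    have hm : 0 < mix V φ c z := by
      rw [hmix]
      refine mul_pos (by positivity) (lt_of_lt_of_le h0 ?_)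
      exact Finset.single_le_sum (f := fun k => V (c (φ k)) z) (fun k _ => hv _) (Finset.mem_univ j)
    have hl := Real.log_le_sub_one_of_pos (x := (mix V φ c z / Q) / s (c (φ j)))
      (by have := hs (c (φ j)); positivity)
    rw [Real.log_div (by positivity) (hs _).ne'] at hl
    nlinarith
  have hw := cbw_pmf (J := J) hP
  refine (Finset.sum_le_sum fun c _ => mul_le_mul_of_nonneg_left (pt c) (hw.1 c)).trans ?_
  simp only [mul_add, mul_sub, Finset.sum_add_distrib, Finset.sum_sub_distrib]
  rw [cbw_one hP (φ j) (fun a => V a z * Real.log (s a)), cbw_one hP (φ j) (fun a => V a z)]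
  have hEh : 0 ≤ ∑ a, P a * h a := Finset.sum_nonneg fun a _ => mul_nonneg (hP.1 a) (hh a)
  have term : ∀ k, ∑ c : J → A, cbw P c * (h (c (φ j)) * V (c (φ k)) z) ≤
      (∑ a, P a * h a) * Q + if k = j then ∑ a, P a * (h a * V a z) else 0 := by
    intro k
    by_cases hk : k = j
    · subst hk
      rw [cbw_one hP (φ k) (fun a => h a * V a z)]
      simp only [if_true]
      have := mul_nonneg hEh hQ.le
      linarith
    · rw [cbw_two hP (fun hc => hk (hφ hc).symm) h (fun a => V a z)]
      simp [hk, hQdef]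
  -- the cross terms need the exact count, so treat them with the diagonal term separately
  have diag : ∑ k, ∑ c : J → A, cbw P c * (h (c (φ j)) * V (c (φ k)) z) ≤
      K * ((∑ a, P a * h a) * Q) + ∑ a, P a * (h a * V a z) := by
    refine (Finset.sum_le_sum fun k _ => term k).trans (le_of_eq ?_)
    rw [Finset.sum_add_distrib]; simp [K]
  have conv : ∑ c : J → A, cbw P c * ((K * Q)⁻¹ * ∑ k, h (c (φ j)) * V (c (φ k)) z) =
      (K * Q)⁻¹ * ∑ k, ∑ c : J → A, cbw P c * (h (c (φ j)) * V (c (φ k)) z) := by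
    rw [Finset.sum_comm, Finset.mul_sum]
    refine Finset.sum_congr rfl fun c _ => ?_
    simp only [Finset.mul_sum]
    refine Finset.sum_congr rfl fun k _ => ?_
    ring
  have fin : (K * Q)⁻¹ * (K * ((∑ a, P a * h a) * Q) + ∑ a, P a * (h a * V a z)) =
      ∑ a, P a * V a z := by
    have : ∀ a, P a * V a z = P a * h a + (K * Q)⁻¹ * (P a * (h a * V a z)) := by
      intro a
      have h1 : h a * s a = V a z := div_mul_cancel₀ _ (hs a).ne'
      have h2 : h a * s a = h a + (K * Q)⁻¹ * (h a * V a z) := by simp only [s]; ring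
      calc P a * V a z = P a * (h a * s a) := by rw [h1]
        _ = _ := by rw [h2]; ring
    rw [Finset.sum_congr rfl (fun a _ => this a), Finset.sum_add_distrib, ← Finset.mul_sum]
    field_simp
  have := mul_le_mul_of_nonneg_left diag (by positivity : 0 ≤ (K * Q)⁻¹)
  rw [fin, ← conv] at this
  linarith

lemma soft_cover {P : A → ℝ} (hP : IsPMF P) {V : A → B → ℝ} (hV : IsChannel V) [Nonempty J0]
    (φ : J0 → J) (hφ : Function.Injective φ) :
    ∑ c : J → A, cbw P c * kl (mix V φ c) (outp P V) ≤
      ∑ a, ∑ z, P a * (V a z * Real.log (1 + V a z / (Fintype.card J0 * outp P V z))) := by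
  have hU := unif_pmf J0
  have e : ∀ c : J → A, cbw P c * kl (mix V φ c) (outp P V) =
      ∑ z, ∑ j, unif J0 j * (cbw P c * (V (c (φ j)) z * Real.log (mix V φ c z / outp P V z))) := by
    intro c
    unfold kl
    rw [Finset.mul_sum]
    refine Finset.sum_congr rfl fun z _ => ?_
    conv_lhs => rw [mix, outp]
    rw [Finset.sum_mul, Finset.mul_sum]
    refine Finset.sum_congr rfl fun j _ => ?_
    simp only [mix, outp]; ring
  simp only [e]
  rw [Finset.sum_comm, Finset.sum_comm (s := (Finset.univ : Finset A))]
  refine Finset.sum_le_sum fun z _ => ?_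
  rw [Finset.sum_comm]
  simp only [← Finset.mul_sum]
  refine (Finset.sum_le_sum fun j _ => mul_le_mul_of_nonneg_left (soft_term hP hV φ hφ z j) (hU.1 j)).trans ?_
  rw [← Finset.sum_mul, hU.2, one_mul]

lemma packing {P : A → ℝ} (hP : IsPMF P) {V : A → B → ℝ} (hV : IsChannel V) [Nonempty J]
    {T : ℝ} (hT : 0 < T) :
    ∃ D : (J → A) → B → J, ∑ c : J → A, cbw P c * errG (fun j => V (c j)) (D c) ≤
      (open Classical in ∑ a, ∑ b, P a * (if V a b ≤ T * outp P V b then V a b else 0)) +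
        Fintype.card J / T := by
  classical
  let D : (J → A) → B → J := fun c b =>
    if h : ∃ j, T * outp P V b < V (c j) b then h.choose else Classical.arbitrary J
  have hU := unif_pmf J
  have hv : ∀ a b, 0 ≤ V a b := fun a => (hV a).1
  have hO := outp_pmf hP hV
  set Q := outp P V
  have pt : ∀ (c : J → A) j b, (if D c b ≠ j then V (c j) b else 0) ≤
      (if V (c j) b ≤ T * Q b then V (c j) b else 0) +
      ∑ k ∈ Finset.univ.erase j, V (c j) b * (if T * Q b < V (c k) b then 1 else 0) := by
    intro c j b
    have nn : ∀ k, 0 ≤ V (c j) b * (if T * Q b < V (c k) b then (1:ℝ) else 0) := fun k =>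
      mul_nonneg (hv _ _) (by split_ifs <;> norm_num)
    have nn2 := Finset.sum_nonneg (fun k (_ : k ∈ Finset.univ.erase j) => nn k)
    by_cases h1 : V (c j) b ≤ T * Q b
    · rw [if_pos h1]
      have : (if D c b ≠ j then V (c j) b else 0) ≤ V (c j) b := by
        split_ifs <;> simp [hv]
      linarith
    · rw [if_neg h1, zero_add]
      by_cases h2 : D c b = j
      · simpa [h2] using nn2
      · rw [if_pos h2]
        have hex : ∃ j, T * Q b < V (c j) b := ⟨j, not_le.1 h1⟩
        have hD : D c b = hex.choose := by simp only [D]; rw [dif_pos hex]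
        have hs := hex.choose_spec
        rw [← hD] at hs
        have := Finset.single_le_sum (f := fun k => V (c j) b * (if T * Q b < V (c k) b then (1:ℝ) else 0))
          (fun k _ => nn k) (Finset.mem_erase.2 ⟨h2, Finset.mem_univ (D c b)⟩)
        simpa [hs] using this
  refine ⟨D, ?_⟩
  have hw := cbw_pmf (J := J) hP
  set X : ℝ := ∑ a, ∑ b, P a * (if V a b ≤ T * Q b then V a b else 0)
  have pair : ∑ b, Q b * ∑ a, P a * (if T * Q b < V a b then (1:ℝ) else 0) ≤ 1 / T := by
    have : ∀ b, Q b * ∑ a, P a * (if T * Q b < V a b then (1:ℝ) else 0) ≤ Q b / T := by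
      intro b
      rw [Finset.mul_sum, le_div_iff₀ hT, Finset.sum_mul]
      refine Finset.sum_le_sum fun a _ => ?_
      split_ifs with h
      · nlinarith [hP.1 a]
      · simpa using mul_nonneg (hP.1 a) (hv a b)
    refine (Finset.sum_le_sum fun b _ => this b).trans (le_of_eq ?_)
    rw [← Finset.sum_div, hO.2]
  have bound : ∀ j : J, ∑ c : J → A, cbw P c * ∑ b, (if D c b ≠ j then V (c j) b else 0) ≤
      X + Fintype.card J / T := by
    intro j
    refine (Finset.sum_le_sum fun c _ => mul_le_mul_of_nonneg_left
      (Finset.sum_le_sum fun b _ => pt c j b) (hw.1 c)).trans ?_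
    simp only [Finset.sum_add_distrib, mul_add]
    refine add_le_add (le_of_eq ?_) ?_
    · rw [cbw_one hP j (fun a => ∑ b, (if V a b ≤ T * Q b then V a b else 0))]
      simp only [Finset.mul_sum, X]
    · have e : ∑ c : J → A, cbw P c * ∑ b, ∑ k ∈ Finset.univ.erase j,
          V (c j) b * (if T * Q b < V (c k) b then (1:ℝ) else 0) =
          ∑ k ∈ Finset.univ.erase j, ∑ b, Q b * ∑ a, P a * (if T * Q b < V a b then (1:ℝ) else 0) := by
        have e0 : ∀ c : J → A, cbw P c * ∑ b, ∑ k ∈ Finset.univ.erase j,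
          V (c j) b * (if T * Q b < V (c k) b then (1:ℝ) else 0) = ∑ b, ∑ k ∈ Finset.univ.erase j,
            cbw P c * (V (c j) b * (if T * Q b < V (c k) b then (1:ℝ) else 0)) := by
          intro c
          rw [Finset.mul_sum]
          refine Finset.sum_congr rfl fun b _ => ?_
          rw [Finset.mul_sum]
        simp only [e0]
        rw [Finset.sum_comm]
        rw [Finset.sum_comm (s := Finset.univ.erase j)]
        refine Finset.sum_congr rfl fun b _ => ?_
        rw [Finset.sum_comm]
        refine Finset.sum_congr rfl fun k hk => ?_
        rw [cbw_two hP (Finset.ne_of_mem_erase hk).symm (fun a => V a b)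
          (fun a => if T * Q b < V a b then (1:ℝ) else 0)]
        rfl
      rw [e]
      refine (Finset.sum_le_sum fun k _ => pair).trans ?_
      rw [Finset.sum_const, nsmul_eq_mul, mul_one_div]
      gcongr
      exact Finset.card_le_univ _
  have e : ∀ c : J → A, cbw P c * errG (fun j => V (c j)) (D c) =
      ∑ j, unif J j * (cbw P c * ∑ b, (if D c b ≠ j then V (c j) b else 0)) := by
    intro c
    unfold errG
    rw [Finset.mul_sum]
    refine Finset.sum_congr rfl fun j _ => ?_
    rw [mul_left_comm, Finset.mul_sum _ _ (unif J j)]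
    congr 1
    refine Finset.sum_congr rfl fun b _ => ?_
    split_ifs <;> simp
  simp only [e]
  rw [Finset.sum_comm]
  simp only [← Finset.mul_sum]
  refine (Finset.sum_le_sum fun j _ => mul_le_mul_of_nonneg_left (bound j) (hU.1 j)).trans ?_
  rw [← Finset.sum_mul, hU.2, one_mul]

end oneshot
section nletter
variable {α β : Type*} [Fintype α] [Fintype β]

lemma sq_sum {γ : Type*} [Fintype γ] {n : ℕ} {r : γ → ℝ} (hr : IsPMF r) (h : γ → ℝ)
    (h0 : ∑ a, r a * h a = 0) :
    ∑ s : Fin n → γ, cbw r s * (∑ i, h (s i)) ^ 2 = n * ∑ a, r a * h a ^ 2 := by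
  have e : ∀ s : Fin n → γ, cbw r s * (∑ i, h (s i)) ^ 2 =
      ∑ i, ∑ k, cbw r s * (h (s i) * h (s k)) := by
    intro s
    rw [pow_two, Finset.sum_mul_sum, Finset.mul_sum]
    refine Finset.sum_congr rfl fun i _ => ?_
    rw [Finset.mul_sum]
  simp only [e]
  rw [Finset.sum_comm]
  have e2 : ∀ i : Fin n, ∑ s : Fin n → γ, ∑ k, cbw r s * (h (s i) * h (s k)) = ∑ a, r a * h a ^ 2 := by
    intro i
    rw [Finset.sum_comm, Finset.sum_eq_single i]
    · rw [cbw_one hr i (fun a => h a * h a)]; simp only [pow_two]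
    · intro k _ hk
      rw [cbw_two hr hk.symm h h, h0, zero_mul]
    · simp
  simp [e2]

/-- information density -/
def dens (p : α → ℝ) (V : α → β → ℝ) (x : α) (y : β) : ℝ := Real.log (V x y / outp p V y)

/-- variance of the information density -/
def vr (p : α → ℝ) (V : α → β → ℝ) : ℝ := ∑ x, ∑ y, p x * V x y * (dens p V x y - minf p V) ^ 2

/-- centered sum of information densities -/
def dev {n : ℕ} (p : α → ℝ) (V : α → β → ℝ) (xs : Fin n → α) (ys : Fin n → β) : ℝ :=
  ∑ i, (dens p V (xs i) (ys i) - minf p V)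

variable {p : α → ℝ} {V : α → β → ℝ}

lemma vr_nonneg (hp : IsPMF p) (hV : IsChannel V) : 0 ≤ vr p V :=
  Finset.sum_nonneg fun x _ => Finset.sum_nonneg fun y _ =>
    mul_nonneg (mul_nonneg (hp.1 x) ((hV x).1 y)) (sq_nonneg _)

lemma lln (hp : IsPMF p) (hV : IsChannel V) (n : ℕ) :
    ∑ xs : Fin n → α, ∑ ys : Fin n → β, cbw p xs * (prodch n V xs ys * dev p V xs ys ^ 2) =
      n * vr p V := by
  let r : α × β → ℝ := fun q => p q.1 * V q.1 q.2
  have hr : IsPMF r := by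
    refine ⟨fun q => mul_nonneg (hp.1 _) ((hV _).1 _), ?_⟩
    rw [Fintype.sum_prod_type]
    simp only [r, ← Finset.mul_sum, (hV _).2, mul_one, hp.2]
  let h : α × β → ℝ := fun q => dens p V q.1 q.2 - minf p V
  have h0 : ∑ a, r a * h a = 0 := by
    simp only [h, mul_sub, Finset.sum_sub_distrib, ← Finset.sum_mul, hr.2, one_mul]
    rw [minf_eq_kl hp.1 (fun a => (hV a).1), Fintype.sum_prod_type, sub_eq_zero]
    refine Finset.sum_congr rfl fun a _ => ?_
    unfold kl
    rw [Finset.mul_sum]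
    refine Finset.sum_congr rfl fun b _ => ?_
    simp only [r, dens]; ring
  have key := sq_sum (n := n) hr h h0
  rw [Fintype.sum_prod_type] at key
  unfold vr
  rw [← key, ← Fintype.sum_prod_type', ← (Equiv.arrowProdEquivProdArrow (Fin n) (fun _ => α) (fun _ => β)).sum_comp]
  refine Finset.sum_congr rfl fun s _ => ?_
  simp only [cbw, prodch, dev, r, h, Finset.prod_mul_distrib, Equiv.arrowProdEquivProdArrow]
  simp [mul_assoc]

lemma outp_cbw {n : ℕ} (ys : Fin n → β) :
    outp (cbw p) (prodch n V) ys = ∏ i, outp p V (ys i) := by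
  simp only [outp, cbw, prodch, ← Finset.prod_mul_distrib]
  rw [sum_prod_fun (fun i a => p a * V a (ys i))]

lemma ratio {n : ℕ} (hp : IsPMF p) (hV : IsChannel V) {xs : Fin n → α} {ys : Fin n → β}
    (h1 : cbw p xs ≠ 0) (h2 : prodch n V xs ys ≠ 0) :
    0 < outp (cbw p) (prodch n V) ys ∧
    prodch n V xs ys / outp (cbw p) (prodch n V) ys = Real.exp (dev p V xs ys + n * minf p V) := by
  have hx := Finset.prod_ne_zero_iff.1 h1
  have hy := Finset.prod_ne_zero_iff.1 h2
  have hpos : ∀ i, 0 < V (xs i) (ys i) := fun i =>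
    lt_of_le_of_ne ((hV _).1 _) (hy i (Finset.mem_univ _)).symm
  have hq : ∀ i, 0 < outp p V (ys i) := fun i => by
    refine lt_of_le_of_ne (outp_nonneg hp.1 (fun a => (hV a).1) _) (fun hh => ?_)
    have := outp_zero hp.1 (fun a => (hV a).1) hh.symm (xs i)
    rcases mul_eq_zero.1 this with h | h
    · exact hx i (Finset.mem_univ _) h
    · exact (hpos i).ne' h
  rw [outp_cbw]
  refine ⟨Finset.prod_pos fun i _ => hq i, ?_⟩
  have : dev p V xs ys + n * minf p V = ∑ i, dens p V (xs i) (ys i) := by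
    simp [dev]
  rw [this, Real.exp_sum, prodch, ← Finset.prod_div_distrib]
  refine Finset.prod_congr rfl fun i _ => ?_
  rw [dens, Real.exp_log (div_pos (hpos i) (hq i))]

lemma rel_n {n : ℕ} (hn : 0 < n) (hp : IsPMF p) (hV : IsChannel V) {δ : ℝ} (hδ : 0 < δ) :
    (open Classical in ∑ a : Fin n → α, ∑ b, cbw p a *
      (if prodch n V a b ≤ Real.exp (n * (minf p V - δ)) * outp (cbw p) (prodch n V) b
        then prodch n V a b else 0)) ≤ vr p V / (n * δ ^ 2) := by
  classical
  have hn' : (0:ℝ) < n := by exact_mod_cast hn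
  have e : vr p V / (n * δ ^ 2) = (∑ xs : Fin n → α, ∑ ys : Fin n → β,
      cbw p xs * (prodch n V xs ys * dev p V xs ys ^ 2)) / (n * δ) ^ 2 := by
    rw [lln hp hV]; field_simp
  rw [e]
  simp only [Finset.sum_div]
  refine Finset.sum_le_sum fun xs _ => Finset.sum_le_sum fun ys _ => ?_
  have c0 : 0 ≤ cbw p xs := (cbw_pmf hp).1 xs
  have v0 : 0 ≤ prodch n V xs ys := (prodch_channel hV xs).1 ys
  have rhs : 0 ≤ cbw p xs * (prodch n V xs ys * dev p V xs ys ^ 2) / (n * δ) ^ 2 := by positivity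
  by_cases h1 : cbw p xs = 0
  · simp [h1]
  by_cases h2 : prodch n V xs ys = 0
  · simp [h2]
  split_ifs with hc
  · obtain ⟨hQ, hr⟩ := ratio hp hV h1 h2
    rw [← div_le_iff₀ hQ, hr, Real.exp_le_exp] at hc
    rw [le_div_iff₀ (by positivity), mul_assoc]
    have hd : n * δ ≤ - dev p V xs ys := by linarith
    have : (n * δ) ^ 2 ≤ dev p V xs ys ^ 2 := by
      have := pow_le_pow_left₀ (by positivity) hd 2
      simpa using this
    gcongr
  · simpa using rhs

lemma cover_n {n : ℕ} (hn : 0 < n) (hp : IsPMF p) (hV : IsChannel V) {K : ℝ}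
    (hK : Real.exp (n * minf p V) ≤ K) :
    ∑ a : Fin n → α, ∑ b, cbw p a * (prodch n V a b *
      Real.log (1 + prodch n V a b / (K * outp (cbw p) (prodch n V) b))) ≤
      Real.log 2 + Real.sqrt n * (vr p V + 1) / 2 := by
  have hn' : (0:ℝ) < n := by exact_mod_cast hn
  have hs : 0 < Real.sqrt n := Real.sqrt_pos.2 hn'
  have hss : Real.sqrt n * Real.sqrt n = n := Real.mul_self_sqrt hn'.le
  have hK0 : 0 < K := lt_of_lt_of_le (Real.exp_pos _) hK
  have pt : ∀ (xs : Fin n → α) (ys : Fin n → β), cbw p xs * (prodch n V xs ys *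
      Real.log (1 + prodch n V xs ys / (K * outp (cbw p) (prodch n V) ys))) ≤
      (cbw p xs * prodch n V xs ys) * (Real.log 2 + Real.sqrt n / 2) +
      (cbw p xs * (prodch n V xs ys * dev p V xs ys ^ 2)) * (1 / (2 * Real.sqrt n)) := by
    intro xs ys
    have c0 : 0 ≤ cbw p xs := (cbw_pmf hp).1 xs
    have v0 : 0 ≤ prodch n V xs ys := (prodch_channel hV xs).1 ys
    by_cases h1 : cbw p xs = 0
    · simp [h1]
    by_cases h2 : prodch n V xs ys = 0
    · simp [h2]
    obtain ⟨hQ, hr⟩ := ratio hp hV h1 h2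
    set d := dev p V xs ys
    have hle : prodch n V xs ys / (K * outp (cbw p) (prodch n V) ys) ≤ Real.exp d := by
      rw [mul_comm K, ← div_div, hr, div_le_iff₀ hK0, Real.exp_add]
      gcongr
    have hl : Real.log (1 + prodch n V xs ys / (K * outp (cbw p) (prodch n V) ys)) ≤
        Real.log 2 + |d| := by
      have : 1 + prodch n V xs ys / (K * outp (cbw p) (prodch n V) ys) ≤ 2 * Real.exp |d| := by
        have h3 : Real.exp d ≤ Real.exp |d| := Real.exp_le_exp.2 (le_abs_self d)
        have h4 : 1 ≤ Real.exp |d| := Real.one_le_exp (abs_nonneg d)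
        linarith
      have h5 : 0 < 1 + prodch n V xs ys / (K * outp (cbw p) (prodch n V) ys) := by positivity
      refine (Real.log_le_log h5 this).trans (le_of_eq ?_)
      rw [Real.log_mul (by norm_num) (Real.exp_pos _).ne', Real.log_exp]
    have habs : |d| ≤ Real.sqrt n / 2 + d ^ 2 * (1 / (2 * Real.sqrt n)) := by
      have : 0 ≤ (|d| - Real.sqrt n) ^ 2 / (2 * Real.sqrt n) := by positivity
      have e : (|d| - Real.sqrt n) ^ 2 / (2 * Real.sqrt n) =
          Real.sqrt n / 2 + d ^ 2 * (1 / (2 * Real.sqrt n)) - |d| := by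
        field_simp
        rw [← sq_abs d]; ring
      linarith
    have := mul_le_mul_of_nonneg_left (hl.trans (add_le_add_right habs _)) (mul_nonneg c0 v0)
    nlinarith
  refine (Finset.sum_le_sum fun xs _ => Finset.sum_le_sum fun ys _ => pt xs ys).trans (le_of_eq ?_)
  simp only [Finset.sum_add_distrib, ← Finset.sum_mul]
  rw [lln hp hV]
  have h1 : ∑ xs : Fin n → α, ∑ ys, cbw p xs * prodch n V xs ys = 1 := by
    simp only [← Finset.mul_sum, (prodch_channel hV _).2, mul_one, (cbw_pmf hp).2]
  rw [h1]
  have : (n:ℝ) * vr p V * (1 / (2 * Real.sqrt n)) = Real.sqrt n * vr p V / 2 := by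
    nth_rewrite 1 [← hss]; field_simp
  rw [this]; ring

lemma minf_nonneg (hp : IsPMF p) (hV : IsChannel V) : 0 ≤ minf p V := by
  rw [minf_eq_kl hp.1 (fun a => (hV a).1)]
  refine Finset.sum_nonneg fun a _ => ?_
  by_cases h : p a = 0
  · simp [h]
  · refine mul_nonneg (hp.1 a) (kl_nonneg (hV a) (outp_pmf hp hV) fun b hb => ?_)
    have := outp_zero hp.1 (fun a => (hV a).1) hb a
    simpa [h] using this

lemma minf_single {M : Type*} [Fintype M] [Unique M] (V : M → β → ℝ) : minf (unif M) V = 0 := by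
  have : outp (unif M) V = V default := by
    funext b; simp [outp, unif]
  simp [minf, this, unif]

end nletter

section leak
variable {A B J J0 M : Type*} [Fintype A] [Fintype B] [Fintype J] [Fintype J0] [DecidableEq J]
  [Fintype M] [Nonempty M] [Nonempty J0]

/-- leakage upper bound functional -/
def leakUB (P : A → ℝ) (V : A → B → ℝ) (Φ : M → J0 → J) (c : J → A) : ℝ :=
  ∑ m, unif M m * kl (mix V (Φ m) c) (outp P V)

lemma leakUB_exp {P : A → ℝ} (hP : IsPMF P) {V : A → B → ℝ} (hV : IsChannel V)
    (Φ : M → J0 → J) (hΦ : ∀ m, Function.Injective (Φ m)) :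
    ∑ c : J → A, cbw P c * leakUB P V Φ c ≤
      ∑ a, ∑ z, P a * (V a z * Real.log (1 + V a z / (Fintype.card J0 * outp P V z))) := by
  have hU := unif_pmf M
  have e : ∀ c : J → A, cbw P c * leakUB P V Φ c =
      ∑ m, unif M m * (cbw P c * kl (mix V (Φ m) c) (outp P V)) := by
    intro c
    rw [leakUB, Finset.mul_sum]
    exact Finset.sum_congr rfl fun m _ => by ring
  simp only [e]
  rw [Finset.sum_comm]
  simp only [← Finset.mul_sum]
  refine (Finset.sum_le_sum fun m _ => mul_le_mul_of_nonneg_left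
    (soft_cover hP hV (Φ m) (hΦ m)) (hU.1 m)).trans ?_
  rw [← Finset.sum_mul, hU.2, one_mul]
  simp only [Finset.mul_sum, le_refl]

lemma mix_channel {V : A → B → ℝ} (hV : IsChannel V) (Φ : M → J0 → J) (c : J → A) :
    IsChannel (fun m => mix V (Φ m) c) :=
  fun m => outp_pmf (unif_pmf J0) (fun j => hV _)

lemma leakUB_spec {P : A → ℝ} (hP : IsPMF P) {V : A → B → ℝ} (hV : IsChannel V)
    (Φ : M → J0 → J) {c : J → A} (hc : 0 < cbw P c) :
    minf (unif M) (fun m => mix V (Φ m) c) ≤ leakUB P V Φ c ∧ 0 ≤ leakUB P V Φ c := by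
  have hU := unif_pmf M
  have ac : ∀ m b, outp P V b = 0 → mix V (Φ m) c b = 0 := by
    intro m b hb
    refine Finset.sum_eq_zero fun j _ => ?_
    have h1 := outp_zero hP.1 (fun a => (hV a).1) hb (c (Φ m j))
    have h2 : P (c (Φ m j)) ≠ 0 := (Finset.prod_ne_zero_iff.1 hc.ne') _ (Finset.mem_univ _)
    have : V (c (Φ m j)) b = 0 := by simpa [h2] using h1
    simp [this]
  refine ⟨minf_le_kl hU (mix_channel hV Φ c) (outp_pmf hP hV) (fun m b hb => by simp [ac m b hb]), ?_⟩
  exact Finset.sum_nonneg fun m _ => mul_nonneg (hU.1 m)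
    (kl_nonneg (mix_channel hV Φ c m) (outp_pmf hP hV) (ac m))

lemma exists_good {C : Type*} [Fintype C] {w F : C → ℝ} (hw : IsPMF w) {b : ℝ}
    (h : ∑ c, w c * F c ≤ b) : ∃ c, 0 < w c ∧ F c ≤ b := by
  by_contra hcon
  push Not at hcon
  have h1 : ∑ c, w c * b < ∑ c, w c * F c := by
    have hne : ∃ c, 0 < w c := by
      by_contra hh
      push Not at hh
      have : ∑ c, w c ≤ 0 := Finset.sum_nonpos fun c _ => hh c
      linarith [hw.2]
    obtain ⟨c0, hc0⟩ := hne
    refine Finset.sum_lt_sum (fun c _ => ?_) ⟨c0, Finset.mem_univ _, ?_⟩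
    · rcases (hw.1 c).eq_or_lt with h0 | h0
      · simp [← h0]
      · exact mul_le_mul_of_nonneg_left (hcon c h0).le (hw.1 c)
    · exact mul_lt_mul_of_pos_left (hcon c0 hc0) hc0
  rw [← Finset.sum_mul, hw.2, one_mul] at h1
  linarith

end leak
section assembly
variable {W : 𝒳 → 𝒴 × 𝒵₁ × 𝒵₂ → ℝ}

/-- stochastic encoder: pick a uniformly random codeword of the sub-codebook of the message -/
def rcEnc {n K₁ K₂ K₀ : ℕ} (c : (Fin K₁ × Fin K₂) × Fin K₀ → (Fin n → 𝒳)) :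
    Fin K₁ × Fin K₂ → (Fin n → 𝒳) → ℝ :=
  fun m => outp (unif (Fin K₀)) (fun k xs => open Classical in if c (m, k) = xs then 1 else 0)

lemma rcEnc_channel {n K₁ K₂ K₀ : ℕ} (hK : 0 < K₀) (c : (Fin K₁ × Fin K₂) × Fin K₀ → (Fin n → 𝒳)) :
    IsChannel (rcEnc c) := by
  classical
  have : Nonempty (Fin K₀) := ⟨⟨0, hK⟩⟩
  intro m
  refine outp_pmf (unif_pmf _) (fun k => ⟨fun xs => ?_, ?_⟩)
  · beta_reduce; split_ifs <;> norm_num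
  · simp

lemma outp_rcEnc {n K₁ K₂ K₀ : ℕ} {B : Type*} [Fintype B]
    (c : (Fin K₁ × Fin K₂) × Fin K₀ → (Fin n → 𝒳)) (V : (Fin n → 𝒳) → B → ℝ) (m : Fin K₁ × Fin K₂) :
    outp (rcEnc c m) V = mix V (fun k : Fin K₀ => (m, k)) c := by
  classical
  unfold rcEnc mix
  rw [outp_assoc]
  congr 1
  funext k b
  simp [outp]

lemma outp_rcEnc1 {n K₁ K₂ K₀ : ℕ} {B : Type*} [Fintype B]
    (c : (Fin K₁ × Fin K₂) × Fin K₀ → (Fin n → 𝒳)) (V : (Fin n → 𝒳) → B → ℝ) (m : Fin K₁) :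
    outp (enc1 (rcEnc c) m) V = mix V (fun k : Fin K₂ × Fin K₀ => ((m, k.1), k.2)) c := by
  funext b
  have h1 : outp (enc1 (rcEnc c) m) V b = ∑ m₂, (K₂:ℝ)⁻¹ * outp (rcEnc c (m, m₂)) V b := by
    simp only [outp, enc1, Finset.sum_mul, Finset.mul_sum]
    rw [Finset.sum_comm]
    simp only [mul_assoc]
  rw [h1]
  simp only [outp_rcEnc]
  simp only [mix, outp, unif, Fintype.sum_prod_type, Finset.mul_sum]
  refine Finset.sum_congr rfl fun _ _ => Finset.sum_congr rfl fun _ _ => ?_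
  simp only [Fintype.card_fin, Fintype.card_prod, Nat.cast_mul, mul_inv]
  ring

lemma errG_proj {M J0 A B : Type*} [Fintype M] [Fintype J0] [Fintype B] [Nonempty J0]
    {V : A → B → ℝ} (hV : IsChannel V) (c : M × J0 → A) (D : B → M × J0) :
    errG (fun m => mix V (fun k : J0 => (m, k)) c) (fun b => (D b).1) ≤
      errG (fun j => V (c j)) D := by
  classical
  unfold errG
  rw [Fintype.sum_prod_type]
  refine Finset.sum_le_sum fun m _ => ?_
  rw [Finset.sum_comm]
  refine Finset.sum_le_sum fun b _ => ?_
  have nn : ∀ k, 0 ≤ unif (M × J0) (m, k) * V (c (m, k)) b := fun k =>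
    mul_nonneg (by unfold unif; positivity) ((hV _).1 _)
  split_ifs with hd
  · have : ∀ k, D b ≠ (m, k) := fun k hh => hd (by simp [hh])
    simp only [this, ne_eq, not_false_eq_true, if_true]
    apply le_of_eq
    simp only [mix, outp, unif, Finset.mul_sum]
    refine Finset.sum_congr rfl fun _ _ => ?_
    simp only [Fintype.card_prod, Nat.cast_mul, mul_inv]
    ring
  · exact Finset.sum_nonneg fun k _ => by
      split_ifs
      · exact nn k
      · exact le_rfl

lemma errG_nonneg {M B : Type*} [Fintype M] [Fintype B] {V : M → B → ℝ} (hV : IsChannel V)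
    (dec : B → M) : 0 ≤ errG V dec := by
  unfold errG
  refine Finset.sum_nonneg fun m _ => Finset.sum_nonneg fun b _ => ?_
  split_ifs
  · exact mul_nonneg (by unfold unif; positivity) ((hV m).1 b)
  · exact le_rfl

/-- trivial code -/
lemma achieve_trivial (hW : IsChannel W) {pX : 𝒳 → ℝ} (hp : IsPMF pX) {R₁ R₂ ε : ℝ} (hε : 0 < ε)
    (h1 : R₁ ≤ ε) (h2 : R₂ ≤ ε) : ∃ n : ℕ, 0 < n ∧ ∃ K₁ K₂ : ℕ, 0 < K₁ ∧ 0 < K₂ ∧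
    (n : ℝ) * (R₁ - ε) ≤ Real.logb 2 K₁ ∧ (n : ℝ) * (R₂ - ε) ≤ Real.logb 2 K₂ ∧
    ∃ enc : Fin K₁ × Fin K₂ → (Fin n → 𝒳) → ℝ, IsChannel enc ∧
      ∃ dec : (Fin n → 𝒴) → Fin K₁ × Fin K₂,
        errProb W enc dec ≤ ε ∧
        leakMZ2 W enc ≤ (n : ℝ) * ε ∧
        leakM1Z1 W enc ≤ (n : ℝ) * ε := by
  have hc : IsChannel (fun _ : Fin 1 × Fin 1 => cbw (J := Fin 1) pX) := fun _ => cbw_pmf hp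
  refine ⟨1, one_pos, 1, 1, one_pos, one_pos, by simpa using h1, by simpa using h2,
    fun _ => cbw pX, hc, fun _ => default, ?_, ?_, ?_⟩
  · have : errProb W (fun _ : Fin 1 × Fin 1 => cbw (J := Fin 1) pX) (fun _ => default) = 0 := by
      unfold errProb
      refine Finset.sum_eq_zero fun m _ => ?_
      have : (default : Fin 1 × Fin 1) = m := Subsingleton.elim _ _
      simp [this]
    rw [this]; exact hε.le
  · have : Unique (Fin 1 × Fin 1) := ⟨⟨(0, 0)⟩, fun _ => Subsingleton.elim _ _⟩
    rw [leakMZ2_eq hW hc, minf_single]; simpa using hε.le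
  · rw [leakM1Z1_eq one_pos hW hc, minf_single]; simpa using hε.le

lemma ceil_bounds {x : ℝ} (hx : 0 ≤ x) :
    0 < ⌈Real.exp x⌉₊ ∧ Real.exp x ≤ ⌈Real.exp x⌉₊ ∧ (⌈Real.exp x⌉₊ : ℝ) ≤ 2 * Real.exp x := by
  have h1 := Real.one_le_exp hx
  refine ⟨Nat.ceil_pos.2 (Real.exp_pos _), Nat.le_ceil _, ?_⟩
  have := Nat.ceil_lt_add_one (Real.exp_pos x).le
  linarith

/-- total bound as a function of the blocklength -/
def bnd (v0 v1 v2 η : ℝ) (n : ℕ) : ℝ :=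
  v0 / (n * (η / 2) ^ 2) + 8 * Real.exp (- (n * (η / 2))) +
    ((Real.log 2 + Real.sqrt n * (v2 + 1) / 2) / (n * Real.log 2) +
      (Real.log 2 + Real.sqrt n * (v1 + 1) / 2) / (n * Real.log 2))

lemma bnd_tendsto (v0 v1 v2 : ℝ) {η : ℝ} (hη : 0 < η) :
    Filter.Tendsto (bnd v0 v1 v2 η) Filter.atTop (nhds 0) := by
  have hN : Filter.Tendsto (fun n : ℕ => (n:ℝ)) Filter.atTop Filter.atTop := tendsto_natCast_atTop_atTop
  have i1 : Filter.Tendsto (fun n : ℕ => ((n:ℝ))⁻¹) Filter.atTop (nhds 0) :=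
    tendsto_inv_atTop_zero.comp hN
  have i2 : Filter.Tendsto (fun n : ℕ => (Real.sqrt n)⁻¹) Filter.atTop (nhds 0) :=
    tendsto_inv_atTop_zero.comp (Real.tendsto_sqrt_atTop.comp hN)
  have i3 : Filter.Tendsto (fun n : ℕ => Real.exp (- ((n:ℝ) * (η / 2)))) Filter.atTop (nhds 0) :=
    Real.tendsto_exp_neg_atTop_nhds_zero.comp (hN.atTop_mul_const (by positivity))
  have key := ((i1.const_mul (v0 / (η / 2) ^ 2)).add (i3.const_mul 8)).add
    (((i1.const_mul 1).add (i2.const_mul ((v2 + 1) / 2 / Real.log 2))).add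
      ((i1.const_mul 1).add (i2.const_mul ((v1 + 1) / 2 / Real.log 2))))
  simp only [mul_zero, add_zero] at key
  refine key.congr' ?_
  filter_upwards [Filter.eventually_gt_atTop 0] with n hn
  have hn' : (0:ℝ) < n := by exact_mod_cast hn
  have hs : 0 < Real.sqrt n := Real.sqrt_pos.2 hn'
  have hl : 0 < Real.log 2 := Real.log_pos (by norm_num)
  have aux : ∀ v : ℝ, 1 * (n:ℝ)⁻¹ + (v + 1) / 2 / Real.log 2 * (Real.sqrt n)⁻¹ =
      (Real.log 2 + Real.sqrt n * (v + 1) / 2) / (n * Real.log 2) := by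
    intro v
    have hss : Real.sqrt n * Real.sqrt n = n := Real.mul_self_sqrt hn'.le
    have : (Real.sqrt n)⁻¹ = Real.sqrt n / n := by
      rw [eq_div_iff hn'.ne']; nth_rewrite 2 [← hss]; field_simp
    rw [this]
    field_simp
  unfold bnd
  rw [aux, aux]
  congr 2
  rw [div_mul_eq_div_div, div_right_comm, div_eq_mul_inv (v0 / _)]

lemma achieve (hW : IsChannel W) {pX : 𝒳 → ℝ} (hp : IsPMF pX) {R₁ R₂ : ℝ}
    (hR1 : 0 ≤ R₁) (hR2 : 0 ≤ R₂)
    (h1 : R₁ * Real.log 2 ≤ minf pX (chY W) - minf pX (ch1 W))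
    (h2 : (R₁ + R₂) * Real.log 2 ≤ minf pX (chY W) - minf pX (ch2 W)) : Achievable W R₁ R₂ := by
  intro ε hε
  by_cases htriv : R₁ ≤ ε ∧ R₂ ≤ ε
  · exact achieve_trivial hW hp hε htriv.1 htriv.2
  have hl : 0 < Real.log 2 := Real.log_pos (by norm_num)
  have hVY := chY_channel hW
  have hV1 := ch1_channel hW
  have hV2 := ch2_channel hW
  set IY := minf pX (chY W)
  set I1 := minf pX (ch1 W)
  set I2 := minf pX (ch2 W)
  set η := ε * Real.log 2 / 2 with hηdef
  have hη : 0 < η := by positivity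
  set ρ1 := max (R₁ - ε) 0 * Real.log 2 with hρ1
  set ρ2 := max (R₂ - ε) 0 * Real.log 2 with hρ2
  set ρ0 := IY - η - ρ1 - ρ2 with hρ0
  have hρ1n : 0 ≤ ρ1 := mul_nonneg (le_max_right _ _) hl.le
  have hρ2n : 0 ≤ ρ2 := mul_nonneg (le_max_right _ _) hl.le
  have hsum : max (R₁ - ε) 0 + max (R₂ - ε) 0 ≤ R₁ + R₂ - ε := by
    by_cases ha : R₁ ≤ ε
    · have hb : ¬ R₂ ≤ ε := fun hb => htriv ⟨ha, hb⟩
      rw [max_eq_right (by linarith), max_eq_left (by linarith)]; linarith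
    · rw [max_eq_left (by linarith)]
      rcases max_cases (R₂ - ε) 0 with h | h <;> linarith
  have hρsum : ρ1 + ρ2 ≤ (R₁ + R₂) * Real.log 2 - 2 * η := by
    have := mul_le_mul_of_nonneg_right hsum hl.le
    simp only [hρ1, hρ2, hηdef]; linarith
  have hρ0I2 : I2 ≤ ρ0 := by linarith
  have hI2 : 0 ≤ I2 := minf_nonneg hp hV2
  have hρ0n : 0 ≤ ρ0 := hI2.trans hρ0I2
  -- choice of the blocklength
  obtain ⟨n, hnb, hn⟩ := (((bnd_tendsto (vr pX (chY W)) (vr pX (ch1 W)) (vr pX (ch2 W)) hη).eventually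
    (gt_mem_nhds hε)).and (Filter.eventually_gt_atTop 0)).exists
  have hn' : (0:ℝ) < n := by exact_mod_cast hn
  obtain ⟨hK1, hK1l, hK1u⟩ := ceil_bounds (mul_nonneg hn'.le hρ1n)
  obtain ⟨hK2, hK2l, hK2u⟩ := ceil_bounds (mul_nonneg hn'.le hρ2n)
  obtain ⟨hK0, hK0l, hK0u⟩ := ceil_bounds (mul_nonneg hn'.le hρ0n)
  set K₁ := ⌈Real.exp (n * ρ1)⌉₊ with hK1def
  set K₂ := ⌈Real.exp (n * ρ2)⌉₊
  set K₀ := ⌈Real.exp (n * ρ0)⌉₊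
  have : Nonempty (Fin K₁) := ⟨⟨0, hK1⟩⟩
  have : Nonempty (Fin K₂) := ⟨⟨0, hK2⟩⟩
  have : Nonempty (Fin K₀) := ⟨⟨0, hK0⟩⟩
  have hlog : ∀ {R ρ : ℝ} {K : ℕ}, ρ = max (R - ε) 0 * Real.log 2 → Real.exp (n * ρ) ≤ K →
      (n:ℝ) * (R - ε) ≤ Real.logb 2 K := by
    intro R ρ K hρ hK
    rw [Real.logb, le_div_iff₀ hl]
    have a1 : n * ρ ≤ Real.log K := (Real.le_log_iff_exp_le (lt_of_lt_of_le (Real.exp_pos _) hK)).2 hK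
    have a2 : (n:ℝ) * ((R - ε) * Real.log 2) ≤ n * ρ := by
      rw [hρ]
      exact mul_le_mul_of_nonneg_left (mul_le_mul_of_nonneg_right (le_max_left _ _) hl.le) hn'.le
    linarith
  refine ⟨n, hn, K₁, K₂, hK1, hK2, hlog hρ1 hK1l, hlog hρ2 hK2l, ?_⟩
  -- random codebook
  set J := (Fin K₁ × Fin K₂) × Fin K₀
  have hPn : IsPMF (cbw (J := Fin n) pX) := cbw_pmf hp
  set P : (Fin n → 𝒳) → ℝ := cbw pX with hPdef
  have hVYn := prodch_channel (n := n) hVY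
  have hV1n := prodch_channel (n := n) hV1
  have hV2n := prodch_channel (n := n) hV2
  have hw := cbw_pmf (J := J) hPn
  -- reliability
  obtain ⟨D, hD⟩ := packing (J := J) hPn hVYn (T := Real.exp (n * (IY - η / 2))) (Real.exp_pos _)
  have hrel : ∑ c : J → (Fin n → 𝒳), cbw P c * errG (fun j => prodch n (chY W) (c j)) (D c) ≤
      vr pX (chY W) / (n * (η / 2) ^ 2) + 8 * Real.exp (- (n * (η / 2))) := by
    refine hD.trans (add_le_add (rel_n hn hp hVY (half_pos hη)) ?_)
    rw [div_le_iff₀ (Real.exp_pos _), mul_assoc, ← Real.exp_add]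
    have e : -(n * (η / 2)) + n * (IY - η / 2) = n * ρ1 + n * ρ2 + n * ρ0 := by
      rw [hρ0]; ring
    rw [e, Real.exp_add, Real.exp_add]
    have : (Fintype.card J : ℝ) = (K₁:ℝ) * K₂ * K₀ := by simp [J]
    rw [this]
    calc (K₁:ℝ) * K₂ * K₀ ≤ (2 * Real.exp (n * ρ1)) * (2 * Real.exp (n * ρ2)) * (2 * Real.exp (n * ρ0)) := by
          gcongr
      _ = _ := by ring
  -- leakage to the weak eavesdropper
  let Φ2 : Fin K₁ × Fin K₂ → Fin K₀ → J := fun m k => (m, k)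
  have hΦ2 : ∀ m, Function.Injective (Φ2 m) := fun m a b h => (Prod.ext_iff.1 h).2
  have hlk2 : ∑ c : J → (Fin n → 𝒳), cbw P c * leakUB P (prodch n (ch2 W)) Φ2 c ≤
      Real.log 2 + Real.sqrt n * (vr pX (ch2 W) + 1) / 2 := by
    refine (leakUB_exp hPn hV2n Φ2 hΦ2).trans (cover_n hn hp hV2 ?_)
    rw [Fintype.card_fin]
    refine le_trans (Real.exp_le_exp.2 ?_) hK0l
    exact mul_le_mul_of_nonneg_left hρ0I2 hn'.le
  -- leakage to the strong eavesdropper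
  have hlk1 : ∃ F : (J → (Fin n → 𝒳)) → ℝ,
      ∑ c : J → (Fin n → 𝒳), cbw P c * F c ≤ Real.log 2 + Real.sqrt n * (vr pX (ch1 W) + 1) / 2 ∧
      ∀ c, 0 < cbw P c → leakM1Z1 W (rcEnc c) * Real.log 2 ≤ F c ∧ 0 ≤ F c := by
    by_cases hR : R₁ ≤ ε
    · have hρ : ρ1 = 0 := by rw [hρ1, max_eq_right (by linarith), zero_mul]
      have hK : K₁ = 1 := by rw [hK1def, hρ]; simp
      refine ⟨fun _ => 0, ?_, fun c _ => ⟨?_, le_rfl⟩⟩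
      · have := vr_nonneg hp hV1
        simp only [mul_zero, Finset.sum_const_zero]; positivity
      · rw [leakM1Z1_eq hK2 hW (rcEnc_channel hK0 c)]
        have : Unique (Fin K₁) := by rw [hK]; infer_instance
        rw [minf_single]; simp
    · let Φ1 : Fin K₁ → Fin K₂ × Fin K₀ → J := fun m k => ((m, k.1), k.2)
      have hΦ1 : ∀ m, Function.Injective (Φ1 m) := by
        intro m a b h
        have h' := Prod.ext_iff.1 h
        exact Prod.ext (Prod.ext_iff.1 h'.1).2 h'.2
      refine ⟨leakUB P (prodch n (ch1 W)) Φ1, ?_, fun c hc => ?_⟩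
      · refine (leakUB_exp hPn hV1n Φ1 hΦ1).trans (cover_n hn hp hV1 ?_)
        have : (Fintype.card (Fin K₂ × Fin K₀) : ℝ) = (K₂:ℝ) * K₀ := by simp
        rw [this]
        have hρ : ρ1 = R₁ * Real.log 2 - 2 * η := by
          rw [hρ1, max_eq_left (by linarith), hηdef]; ring
        calc Real.exp (n * I1) ≤ Real.exp (n * ρ2 + n * ρ0) := by
              rw [Real.exp_le_exp, ← mul_add]
              refine mul_le_mul_of_nonneg_left ?_ hn'.le
              linarith
          _ = Real.exp (n * ρ2) * Real.exp (n * ρ0) := Real.exp_add _ _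
          _ ≤ _ := by gcongr
      · rw [leakM1Z1_eq hK2 hW (rcEnc_channel hK0 c), div_mul_cancel₀ _ hl.ne']
        simp only [outp_rcEnc1]
        exact leakUB_spec hPn hV1n Φ1 hc
  obtain ⟨F1, hF1, hF1s⟩ := hlk1
  -- select a codebook
  have hnl : 0 < n * Real.log 2 := by positivity
  obtain ⟨c, hc, hgood⟩ := exists_good (w := cbw (J := J) P)
    (F := fun c => errG (fun j => prodch n (chY W) (c j)) (D c) +
      (leakUB P (prodch n (ch2 W)) Φ2 c / (n * Real.log 2) + F1 c / (n * Real.log 2)))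
    (b := bnd (vr pX (chY W)) (vr pX (ch1 W)) (vr pX (ch2 W)) η n) hw (by
      simp only [mul_add, Finset.sum_add_distrib, ← mul_div_assoc, ← Finset.sum_div]
      unfold bnd
      gcongr)
  have g1 : 0 ≤ errG (fun j => prodch n (chY W) (c j)) (D c) := errG_nonneg (fun j => hVYn _) _
  obtain ⟨g2, g2'⟩ := leakUB_spec hPn hV2n Φ2 hc
  obtain ⟨g3, g3'⟩ := hF1s c hc
  have g2'' := div_nonneg g2' hnl.le
  have g3'' := div_nonneg g3' hnl.le
  refine ⟨rcEnc c, rcEnc_channel hK0 c, fun y => (D c y).1, ?_, ?_, ?_⟩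
  · rw [errProb_eq]
    simp only [outp_rcEnc]
    refine (errG_proj hVYn c (D c)).trans ?_
    linarith
  · rw [leakMZ2_eq hW (rcEnc_channel hK0 c), div_le_iff₀ hl]
    simp only [outp_rcEnc]
    refine g2.trans ?_
    have : leakUB P (prodch n (ch2 W)) Φ2 c / (n * Real.log 2) ≤ ε := by linarith
    rw [div_le_iff₀ hnl] at this
    linarith
  · have : F1 c / (n * Real.log 2) ≤ ε := by linarith
    rw [div_le_iff₀ hnl] at this
    refine le_of_mul_le_mul_right ?_ hl
    linarith

end assembly

/-- for a discrete memoryless two-level security wiretap channel with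
`X → Z₁ → Z₂`, `X → Y → Z₂` and `X → Y → Z₁`, the secrecy capacity region is exactly the
set of nonnegative pairs with `R₁ ≤ I(X;Y) − I(X;Z₁)` and `R₁ + R₂ ≤ I(X;Y) − I(X;Z₂)`
for some input distribution `p(x)`. -/
theorem stmt5_capacity_region_fully_degraded
    (W : 𝒳 → 𝒴 × 𝒵₁ × 𝒵₂ → ℝ) (hW : IsChannel W)
    (hdeg₁ : DegradedZ1Z2 W) (hdeg₂ : DegradedYZ2 W) (hdeg₃ : DegradedYZ1 W) :
    {R : ℝ × ℝ | 0 ≤ R.1 ∧ 0 ≤ R.2 ∧ Achievable W R.1 R.2} =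
    {R : ℝ × ℝ | 0 ≤ R.1 ∧ 0 ≤ R.2 ∧
      ∃ pX : 𝒳 → ℝ, IsPMF pX ∧
        R.1 ≤ mutInfo (jointXY pX W) - mutInfo (jointXZ1 pX W) ∧
        R.1 + R.2 ≤ mutInfo (jointXY pX W) - mutInfo (jointXZ2 pX W)} := by
  have hl : 0 < Real.log 2 := Real.log_pos (by norm_num)
  ext ⟨R₁, R₂⟩
  simp only [Set.mem_setOf_eq]
  constructor
  · rintro ⟨h1, h2, h⟩
    obtain ⟨pX, hp, a, b⟩ := converse hW hdeg₂ hdeg₃ h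
    refine ⟨h1, h2, pX, hp, ?_, ?_⟩
    · rw [mutInfo_XY hW hp, mutInfo_XZ1 hW hp, ← sub_div, le_div_iff₀ hl]; exact a
    · rw [mutInfo_XY hW hp, mutInfo_XZ2 hW hp, ← sub_div, le_div_iff₀ hl]; exact b
  · rintro ⟨h1, h2, pX, hp, a, b⟩
    rw [mutInfo_XY hW hp, mutInfo_XZ1 hW hp, ← sub_div, le_div_iff₀ hl] at a
    rw [mutInfo_XY hW hp, mutInfo_XZ2 hW hp, ← sub_div, le_div_iff₀ hl] at b
    exact ⟨h1, h2, achieve hW hp h1 h2 a b⟩
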